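/- Let G be a 3-connected planar graph and C a cycle in G. Then C is a facial cycle of (every planar embedding of) G if and only if C is an induced subgraph of G and G − V(C) is connected. -/

import Mathlib

open SimpleGraph

/-- A topological planar embedding of a simple graph: vertices are mapped to
distinct points of the plane, and every edge is realised by a simple arc
joining the images of its endpoints, such that the interior of each arc avoids
all vertex points and two distinct arcs meet only in common endpoints. -/
structure PlanarEmbedding {V : Type} (G : SimpleGraph V) where
  /-- position of the vertices -/
  pos : V → ℝ × ℝ
  pos_inj : Function.Injective pos
  /-- the arc realising an edge, as a subset of the plane -/
  arc : Sym2 V → Set (ℝ × ℝ)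
  /-- each edge arc is a simple arc from the image of one endpoint to the other -/
  arc_param : ∀ ⦃u v : V⦄, G.Adj u v → ∃ γ : ℝ → ℝ × ℝ,
    ContinuousOn γ (Set.Icc 0 1) ∧ Set.InjOn γ (Set.Icc 0 1) ∧
    γ '' Set.Icc 0 1 = arc s(u, v) ∧ γ 0 = pos u ∧ γ 1 = pos v
  /-- the only vertex points on the arc of an edge are its endpoints -/
  arc_vertex : ∀ ⦃u v : V⦄, G.Adj u v → ∀ w : V, pos w ∈ arc s(u, v) → w = u ∨ w = v
  /-- two arcs of distinct edges meet only in vertex points (hence, by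
  `arc_vertex`, only in common endpoints) -/
  arc_inter : ∀ ⦃u v u' v' : V⦄, G.Adj u v → G.Adj u' v' → s(u, v) ≠ s(u', v') →
    arc s(u, v) ∩ arc s(u', v') ⊆ Set.range pos

/-- The image (point set) of a planar embedding. -/
def PlanarEmbedding.image {V : Type} {G : SimpleGraph V} (emb : PlanarEmbedding G) :
    Set (ℝ × ℝ) :=
  Set.range emb.pos ∪ ⋃ e ∈ G.edgeSet, emb.arc e

/-- A graph is planar if it has a planar embedding. -/
def SimpleGraph.Planar {V : Type} (G : SimpleGraph V) : Prop :=
  Nonempty (PlanarEmbedding G)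


attribute [local instance] Classical.propDecidable

/-- A graph is `k`-connected if it has more than `k` vertices and removing any
set of at most `k - 1` vertices leaves it connected. -/
def IsKConnected {V : Type} [Fintype V] (k : ℕ) (G : SimpleGraph V) : Prop :=
  k < Fintype.card V ∧ ∀ S : Set V, S.ncard ≤ k - 1 → (G.induce Sᶜ).Connected

/-- The embedded image of a walk: the vertex points of its support together
with the arcs of its edges. -/
def PlanarEmbedding.walkImage {V : Type} {G : SimpleGraph V} (emb : PlanarEmbedding G)
    {a b : V} (w : G.Walk a b) : Set (ℝ × ℝ) :=
  (emb.pos '' {x | x ∈ w.support}) ∪ ⋃ e ∈ w.edges, emb.arc e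

/-- A cycle (given as a closed walk `w`) is facial in the embedding `emb` if
its embedded image is the frontier of some face, i.e. of some connected
component of the complement of the image of the embedding. -/
def PlanarEmbedding.IsFacial {V : Type} {G : SimpleGraph V} (emb : PlanarEmbedding G)
    {a : V} (w : G.Walk a a) : Prop :=
  ∃ z ∈ emb.imageᶜ, emb.walkImage w = frontier (connectedComponentIn emb.imageᶜ z)

namespace Whit
open Set Complex

def HasLog (X : Set ℂ) (f : ℂ → ℂ) : Prop :=
  ∃ g : ℂ → ℂ, ContinuousOn g X ∧ ∀ z ∈ X, exp (g z) = f z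

lemma lift_hom {A : Type*} [TopologicalSpace A] (H : unitInterval × A → ℂ) (hH : Continuous H)
    (hne : ∀ x, H x ≠ 0) (f : A → ℂ) (hf : Continuous f) (h0 : ∀ a, exp (f a) = H (0, a)) :
    ∃ g : A → ℂ, Continuous g ∧ ∀ a, exp (g a) = H (1, a) := by
  let H' : C(unitInterval × A, {z : ℂ // z ≠ 0}) := ⟨fun x => ⟨H x, hne x⟩, by fun_prop⟩
  let f' : C(A, ℂ) := ⟨f, hf⟩
  have h0' : ∀ a, H' (0, a) = (fun z : ℂ ↦ (⟨_, z.exp_ne_zero⟩ : {z : ℂ // z ≠ 0})) (f' a) := by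
    intro a; exact Subtype.ext (h0 a).symm
  refine ⟨fun a => isCoveringMap_exp.liftHomotopy H' f' h0' (1, a), by fun_prop, fun a => ?_⟩
  have := congr_fun (isCoveringMap_exp.liftHomotopy_lifts H' f' h0') (1, a)
  exact congrArg Subtype.val this

lemma lift_hom_on (X : Set ℂ) (H : unitInterval × X → ℂ) (hH : Continuous H)
    (hne : ∀ x, H x ≠ 0) (f : X → ℂ) (hf : Continuous f) (h0 : ∀ a, exp (f a) = H (0, a))
    (F : ℂ → ℂ) (hF : ∀ a : X, F a = H (1, a)) : HasLog X F := by
  obtain ⟨g, hg, hge⟩ := lift_hom H hH hne f hf h0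
  classical
  refine ⟨fun z => if h : z ∈ X then g ⟨z, h⟩ else 0, ?_, ?_⟩
  · rw [continuousOn_iff_continuous_domRestrict]
    convert hg using 1
    ext ⟨z, hz⟩
    simp [Set.domRestrict, hz]
  · intro z hz
    simp only [hz, dif_pos]
    rw [hge, hF ⟨z, hz⟩]

lemma log_of_joined {Y : Set ℂ} {p q : ℂ} (h : JoinedIn Y p q) :
    HasLog Yᶜ (fun z => (z - p) / (z - q)) := by
  obtain ⟨γ, hγ⟩ := h.symm
  have hn : ∀ (z : (Yᶜ : Set ℂ)) t, (z : ℂ) - γ t ≠ 0 := by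
    intro z t h
    have := hγ t
    rw [← sub_eq_zero.1 h] at this
    exact z.2 this
  refine lift_hom_on _ (fun x => ((x.2 : ℂ) - γ x.1) / (x.2 - q)) ?_ ?_ (fun _ => 0) (by fun_prop)
    ?_ _ ?_
  · refine Continuous.div (by fun_prop) (by fun_prop) ?_
    intro x; have := hn x.2 0; simpa using this
  · intro x
    refine div_ne_zero (hn _ _) ?_
    have := hn x.2 0; simpa using this
  · intro a
    have := hn a 0
    simp at this
    simp [this]
  · intro a; simp

/-- nonseparation -/
def NS (X : Set ℂ) (p q : ℂ) : Prop :=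
  ∃ S, IsPreconnected S ∧ p ∈ S ∧ q ∈ S ∧ S ⊆ Xᶜ

lemma NS.symm {X : Set ℂ} {p q : ℂ} (h : NS X p q) : NS X q p := by
  obtain ⟨S, a, b, c, d⟩ := h; exact ⟨S, a, c, b, d⟩

lemma NS.log {X : Set ℂ} (hX : IsClosed X) {p q : ℂ} (h : NS X p q) :
    HasLog X (fun z => (z - p) / (z - q)) := by
  obtain ⟨S, h1, h2, h3, h4⟩ := h
  have hsub := h1.subset_connectedComponentIn h2 h4
  have ho : IsOpen (connectedComponentIn Xᶜ p) := hX.isOpen_compl.connectedComponentIn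
  have hc : IsConnected (connectedComponentIn Xᶜ p) := isConnected_connectedComponentIn_iff.2 (h4 h2)
  have hp := (ho.isConnected_iff_isPathConnected).1 hc
  have hj := hp.joinedIn p (hsub h2) q (hsub h3)
  have := log_of_joined (hj.mono (connectedComponentIn_subset _ _))
  rwa [compl_compl] at this

lemma log_glue {U V : Set ℂ} {f : ℂ → ℂ} (hU : HasLog U f) (hV : HasLog V f)
    (hUV : IsPreconnected (U ∩ V)) (h : (IsOpen U ∧ IsOpen V) ∨ (IsClosed U ∧ IsClosed V)) :
    HasLog (U ∪ V) f := by
  classical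
  obtain ⟨g, hg, hge⟩ := hU
  obtain ⟨k, hk, hke⟩ := hV
  obtain ⟨k', hk', hke', heq⟩ : ∃ k' : ℂ → ℂ, ContinuousOn k' V ∧ (∀ z ∈ V, exp (k' z) = f z) ∧
      ∀ z ∈ U ∩ V, g z = k' z := by
    rcases (U ∩ V).eq_empty_or_nonempty with h0 | ⟨z0, hz0⟩
    · exact ⟨k, hk, hke, by simp [h0]⟩
    · have hc : exp (g z0 - k z0) = 1 := by
        rw [exp_sub, hge _ hz0.1, hke _ hz0.2, div_self]
        rw [← hge _ hz0.1]; exact exp_ne_zero _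
      have hke' : ∀ z ∈ V, exp (k z + (g z0 - k z0)) = f z := by
        intro z hz; rw [exp_add, hc, hke z hz, mul_one]
      refine ⟨fun z => k z + (g z0 - k z0), by fun_prop, hke', ?_⟩
      refine isCoveringMap_exp.eqOn_of_comp_eqOn hUV (hg.mono inter_subset_left)
        (ContinuousOn.mono (by fun_prop) inter_subset_right) ?_ hz0 (by ring)
      intro z hz
      apply Subtype.ext
      simp only [Function.comp]
      rw [hge z hz.1, hke' z hz.2]
  have e1 : EqOn (fun z => if z ∈ U then g z else k' z) g U := by
    intro z hz; simp [hz]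
  have e2 : EqOn (fun z => if z ∈ U then g z else k' z) k' V := by
    intro z hz
    by_cases hzU : z ∈ U
    · simp [hzU, heq z ⟨hzU, hz⟩]
    · simp [hzU]
  refine ⟨fun z => if z ∈ U then g z else k' z, ?_, ?_⟩
  · have c1 := hg.congr e1
    have c2 := hk'.congr e2
    rcases h with ⟨h1, h2⟩ | ⟨h1, h2⟩
    · exact c1.union_of_isOpen c2 h1 h2
    · exact c1.union_of_isClosed c2 h1 h2
  · rintro z (hz | hz)
    · rw [e1 hz, hge z hz]
    · rw [e2 hz, hke' z hz]

/-- the circle has no logarithm -/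
lemma no_log_circle (p : ℂ) (r : ℝ) (hr : 0 < r) : ¬ HasLog (Metric.sphere p r) (fun z => z - p) := by
  rintro ⟨g, hg, hge⟩
  let c : ℝ → ℂ := fun t => p + r * exp (t * I)
  have hc : Continuous c := by fun_prop
  have hcs : ∀ t, c t ∈ Metric.sphere p r := by
    intro t
    simp [c, Complex.norm_exp_ofReal_mul_I, abs_of_pos hr]
  have h1 : Continuous (fun t => g (c t)) := hg.comp_continuous hc hcs
  have h2 : Continuous (fun t : ℝ => Complex.log r + t * I) := by fun_prop
  have he : ∀ t : ℝ, exp (g (c t)) = r * exp (t * I) := by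
    intro t; rw [hge _ (hcs t)]; simp [c]
  have hr' : (r : ℂ) ≠ 0 := by exact_mod_cast hr.ne'
  have hs : ∀ t : ℝ, exp (g (c t) - t * I - g (c 0)) = 1 := by
    intro t
    rw [exp_sub, exp_sub, he, he]
    simp [hr']
  have h3 : Continuous (fun t : ℝ => g (c t) - t * I - g (c 0)) :=
    (h1.sub (by fun_prop)).sub continuous_const
  have key := isCoveringMap_exp.constOn_of_comp (isPreconnected_univ (α := ℝ)) h3.continuousOn
    (fun a _ b _ => Subtype.ext ((hs a).trans (hs b).symm)) (mem_univ 0) (mem_univ (2 * Real.pi))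
  have hcc : c (2 * Real.pi) = c 0 := by simp [c]
  simp only [hcc] at key
  simp at key

/-- complement of a ball is preconnected -/
lemma preconn_compl_ball (R : ℝ) (hR : 0 < R) : IsPreconnected (Metric.closedBall (0 : ℂ) R)ᶜ := by
  have : (Metric.closedBall (0 : ℂ) R)ᶜ = exp '' {z | Real.log R < z.re} := by
    ext z
    simp only [mem_compl_iff, Metric.mem_closedBall, dist_zero_right, not_le, mem_image]
    constructor
    · intro h
      refine ⟨log z, ?_, exp_log ?_⟩
      · show Real.log R < (log z).re
        rw [Complex.log_re]
        exact Real.log_lt_log hR h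
      · rintro rfl; simp at h; linarith
    · rintro ⟨x, hx, rfl⟩
      rw [Complex.norm_exp]
      exact (Real.log_lt_iff_lt_exp hR).1 hx
  rw [this]
  exact ((convex_halfSpace_re_gt _).isPreconnected).image _ continuous_exp.continuousOn

lemma log_plane (h : ℂ → ℂ) (hc : Continuous h) (hne : ∀ z, h z ≠ 0) : HasLog univ h := by
  refine lift_hom_on univ (fun x => h ((x.1 : ℝ) * (x.2 : ℂ))) (by fun_prop) (fun _ => hne _)
    (fun _ => log (h 0)) (by fun_prop) ?_ h ?_
  · intro a; simp [exp_log (hne 0)]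
  · intro a; simp

lemma ns_of_log_aux {X : Set ℂ} (hX : IsCompact X) {p q : ℂ} (hp : p ∉ X) (hq : q ∉ X)
    (hl : HasLog X (fun z => (z - p) / (z - q)))
    (hb : Bornology.IsBounded (connectedComponentIn Xᶜ p)) : NS X p q := by
  classical
  set U := connectedComponentIn Xᶜ p with hU
  by_contra hn
  have hpU : p ∈ U := mem_connectedComponentIn hp
  have hUX : U ⊆ Xᶜ := connectedComponentIn_subset _ _
  have hqU : q ∉ U := fun h => hn ⟨U, isPreconnected_connectedComponentIn, hpU, h, hUX⟩
  have hUo : IsOpen U := hX.isClosed.isOpen_compl.connectedComponentIn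
  obtain ⟨g, hg, hge⟩ := hl
  obtain ⟨G, hG⟩ := ContinuousMap.exists_restrict_eq hX.isClosed
    (⟨X.domRestrict g, continuousOn_iff_continuous_domRestrict.1 hg⟩ : C(X, ℂ))
  have hGX : ∀ z ∈ X, G z = g z := by
    intro z hz
    exact congrArg (fun F : C(X, ℂ) => F ⟨z, hz⟩) hG
  have hfr : frontier U ⊆ X := by
    intro z hz
    by_contra hzX
    have hzU : z ∉ U := by
      rw [hUo.frontier_eq] at hz; exact hz.2
    have hzc : z ∈ closure U := hz.1
    have hin : connectedComponentIn Xᶜ z ∩ U = ∅ := by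
      by_contra hne
      obtain ⟨y, hy1, hy2⟩ := nonempty_iff_ne_empty.2 hne
      have e1 := connectedComponentIn_eq hy1
      have e2 := connectedComponentIn_eq hy2
      apply hzU
      rw [hU, e2, ← e1]
      exact mem_connectedComponentIn hzX
    have ho : IsOpen (connectedComponentIn Xᶜ z) := hX.isClosed.isOpen_compl.connectedComponentIn
    obtain ⟨y, hy⟩ := mem_closure_iff.1 hzc _ ho (mem_connectedComponentIn hzX)
    rw [hin] at hy; exact hy
  let h : ℂ → ℂ := fun z => if z ∈ U then (z - q) * exp (G z) else z - p
  have hcont : Continuous h := by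
    refine Continuous.if ?_ (by fun_prop) (by fun_prop)
    intro z hz
    have hzX := hfr hz
    rw [hGX z hzX, hge z hzX]
    have : z - q ≠ 0 := fun h => hq (by rwa [← sub_eq_zero.1 h])
    field_simp
  have hne : ∀ z, h z ≠ 0 := by
    intro z
    by_cases hz : z ∈ U
    · simp only [h, hz, if_true]
      refine mul_ne_zero (fun h => hqU (by rwa [← sub_eq_zero.1 h])) (exp_ne_zero _)
    · simp only [h, hz, if_false]
      exact fun h => hz (by rwa [sub_eq_zero.1 h])
  obtain ⟨k, hk, hke⟩ := log_plane h hcont hne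
  obtain ⟨r, hr⟩ := hb.subset_ball p
  have hr0 : 0 < r := by have := hr hpU; simpa using this
  refine no_log_circle p r hr0 ⟨k, hk.mono (subset_univ _), fun z hz => ?_⟩
  rw [hke z (mem_univ _)]
  have : z ∉ U := fun hzU => by
    have h1 := hr hzU
    rw [Metric.mem_ball] at h1
    rw [Metric.mem_sphere] at hz
    linarith
  simp [h, this]

lemma HasLog.inv {X : Set ℂ} {p q : ℂ} (hl : HasLog X (fun z => (z - p) / (z - q))) :
    HasLog X (fun z => (z - q) / (z - p)) := by
  obtain ⟨g, hg, hge⟩ := hl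
  refine ⟨fun z => - g z, hg.neg, fun z hz => ?_⟩
  rw [exp_neg, hge z hz, inv_div]

lemma ns_of_log {X : Set ℂ} (hX : IsCompact X) {p q : ℂ} (hp : p ∉ X) (hq : q ∉ X)
    (hl : HasLog X (fun z => (z - p) / (z - q))) : NS X p q := by
  by_cases hb : Bornology.IsBounded (connectedComponentIn Xᶜ p)
  · exact ns_of_log_aux hX hp hq hl hb
  by_cases hb' : Bornology.IsBounded (connectedComponentIn Xᶜ q)
  · exact (ns_of_log_aux hX hq hp hl.inv hb').symm
  obtain ⟨r, hr⟩ := hX.isBounded.subset_closedBall 0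
  set R := max r 1
  have hR : 0 < R := by positivity
  have hXR : (Metric.closedBall (0 : ℂ) R)ᶜ ⊆ Xᶜ := by
    apply compl_subset_compl.2
    exact hr.trans (Metric.closedBall_subset_closedBall (le_max_left _ _))
  have meet : ∀ x, ¬ Bornology.IsBounded (connectedComponentIn Xᶜ x) →
      ∃ y ∈ (Metric.closedBall (0 : ℂ) R)ᶜ, y ∈ connectedComponentIn Xᶜ x := by
    intro x hx
    by_contra hcon
    push Not at hcon
    apply hx
    refine (Metric.isBounded_closedBall (x := (0 : ℂ)) (r := R)).subset (fun y hy => ?_)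
    by_contra h; exact hcon y h hy
  obtain ⟨y1, h1, h1'⟩ := meet p hb
  obtain ⟨y2, h2, h2'⟩ := meet q hb'
  have e := (preconn_compl_ball R hR).subset_connectedComponentIn h1 hXR h2
  rw [← connectedComponentIn_eq h1'] at e
  have e3 := connectedComponentIn_eq h2'
  have e4 := connectedComponentIn_eq e
  refine ⟨connectedComponentIn Xᶜ p, isPreconnected_connectedComponentIn,
    mem_connectedComponentIn hp, ?_, connectedComponentIn_subset _ _⟩
  rw [e4, ← e3]
  exact mem_connectedComponentIn hq

lemma NS.mem_left {X : Set ℂ} {p q : ℂ} (h : NS X p q) : p ∉ X := by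
  obtain ⟨S, a, b, c, d⟩ := h; exact d b
lemma NS.mem_right {X : Set ℂ} {p q : ℂ} (h : NS X p q) : q ∉ X := h.symm.mem_left

lemma janiszewski {X Y : Set ℂ} (hX : IsCompact X) (hY : IsCompact Y)
    (hXY : IsPreconnected (X ∩ Y)) {p q : ℂ} (h1 : NS X p q) (h2 : NS Y p q) : NS (X ∪ Y) p q := by
  refine ns_of_log (hX.union hY) ?_ ?_ ?_
  · rintro (h | h); exacts [h1.mem_left h, h2.mem_left h]
  · rintro (h | h); exacts [h1.mem_right h, h2.mem_right h]
  · exact log_glue (h1.log hX.isClosed) (h2.log hY.isClosed) hXY (Or.inr ⟨hX.isClosed, hY.isClosed⟩)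

end Whit

namespace Whit
open Set Complex

def IsArc {E : Type*} [TopologicalSpace E] (A : Set E) (a b : E) : Prop :=
  ∃ γ : ℝ → E, ContinuousOn γ (Icc 0 1) ∧ InjOn γ (Icc 0 1) ∧ γ '' Icc 0 1 = A ∧ γ 0 = a ∧ γ 1 = b

section
variable {E : Type*} [TopologicalSpace E] {A B : Set E} {a b c : E}

lemma IsArc.compact (h : IsArc A a b) : IsCompact A := by
  obtain ⟨γ, h1, h2, rfl, rfl, rfl⟩ := h
  exact isCompact_Icc.image_of_continuousOn h1

lemma IsArc.preconn (h : IsArc A a b) : IsPreconnected A := by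
  obtain ⟨γ, h1, h2, rfl, rfl, rfl⟩ := h
  exact isPreconnected_Icc.image _ h1

lemma IsArc.left (h : IsArc A a b) : a ∈ A := by
  obtain ⟨γ, h1, h2, rfl, rfl, rfl⟩ := h
  exact ⟨0, by simp, rfl⟩

lemma IsArc.right (h : IsArc A a b) : b ∈ A := by
  obtain ⟨γ, h1, h2, rfl, rfl, rfl⟩ := h
  exact ⟨1, by simp, rfl⟩

lemma IsArc.ne (h : IsArc A a b) : a ≠ b := by
  obtain ⟨γ, h1, h2, rfl, rfl, rfl⟩ := h
  intro h
  have := h2 (by simp) (by simp) h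
  norm_num at this

lemma IsArc.symm (h : IsArc A a b) : IsArc A b a := by
  obtain ⟨γ, h1, h2, rfl, rfl, rfl⟩ := h
  have hm : MapsTo (fun t : ℝ => 1 - t) (Icc 0 1) (Icc 0 1) := by
    intro t ht; simp at ht ⊢; constructor <;> linarith
  refine ⟨fun t => γ (1 - t), h1.comp (by fun_prop) hm, ?_, ?_, by simp, by simp⟩
  · intro s hs t ht hst
    have := h2 (hm hs) (hm ht) hst
    simpa using this
  · ext x
    constructor
    · rintro ⟨t, ht, rfl⟩; exact ⟨1 - t, hm ht, rfl⟩
    · rintro ⟨t, ht, rfl⟩; exact ⟨1 - t, hm ht, by simp⟩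

lemma IsArc.trans (h : IsArc A a b) (h' : IsArc B b c) (hAB : A ∩ B ⊆ {b}) : IsArc (A ∪ B) a c := by
  obtain ⟨γ, h1, h2, rfl, rfl, hb⟩ := h
  obtain ⟨δ, k1, k2, rfl, hb', rfl⟩ := h'
  have m1 : ∀ t : ℝ, t ∈ Icc (0:ℝ) 1 → t ≤ 1/2 → 2 * t ∈ Icc (0:ℝ) 1 := by
    intro t ht h; simp at ht ⊢; constructor <;> linarith
  have m2 : ∀ t : ℝ, t ∈ Icc (0:ℝ) 1 → 1/2 ≤ t → 2 * t - 1 ∈ Icc (0:ℝ) 1 := by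
    intro t ht h; simp at ht ⊢; constructor <;> linarith
  have cross : ∀ s t : ℝ, s ∈ Icc (0:ℝ) 1 → t ∈ Icc (0:ℝ) 1 → s ≤ 1/2 → ¬ t ≤ 1/2 →
      γ (2 * s) ≠ δ (2 * t - 1) := by
    intro s t hs ht hs' ht' heq
    have := hAB ⟨⟨_, m1 s hs hs', rfl⟩, by rw [heq]; exact ⟨_, m2 t ht (by linarith), rfl⟩⟩
    rw [mem_singleton_iff] at this
    rw [heq, ← hb'] at this
    have := k2 (m2 t ht (by linarith)) (by simp) this
    linarith
  refine ⟨fun t => if t ≤ 1/2 then γ (2 * t) else δ (2 * t - 1), ?_, ?_, ?_, by simp, by norm_num⟩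
  · refine ContinuousOn.if ?_ ?_ ?_
    · intro t ht
      have : t = 1/2 := by
        have := frontier_le_subset_eq (continuous_id) (continuous_const) ht.2
        simpa using this
      subst this
      norm_num [hb, hb']
    · refine h1.comp (by fun_prop) ?_
      intro t ht
      refine m1 t ht.1 ?_
      have := closure_le_eq (continuous_id) (continuous_const (y := (1/2:ℝ))) ▸ ht.2
      simpa using this
    · refine k1.comp (by fun_prop) ?_
      intro t ht
      refine m2 t ht.1 ?_
      have h := ht.2
      simp only [not_le] at h
      exact closure_lt_subset_le continuous_const continuous_id h
  · intro s hs t ht hst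
    by_cases h1 : s ≤ 1/2 <;> by_cases h2' : t ≤ 1/2
    · simp only [h1, h2', if_true] at hst
      have := h2 (m1 s hs h1) (m1 t ht h2') hst
      linarith
    · simp only [h1, h2', if_true, if_false] at hst
      exact absurd hst (cross s t hs ht h1 h2')
    · simp only [h1, h2', if_true, if_false] at hst
      exact absurd hst.symm (cross t s ht hs h2' h1)
    · simp only [h1, h2', if_false] at hst
      have := k2 (m2 s hs (by linarith)) (m2 t ht (by linarith)) hst
      linarith
  · ext x
    constructor
    · rintro ⟨t, ht, rfl⟩
      by_cases h : t ≤ 1/2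
      · left; simp only [h, if_true]; exact ⟨_, m1 t ht h, rfl⟩
      · right; simp only [h, if_false]; exact ⟨_, m2 t ht (by linarith), rfl⟩
    · rintro (⟨t, ht, rfl⟩ | ⟨t, ht, rfl⟩)
      · refine ⟨t / 2, ⟨by linarith [ht.1], by linarith [ht.2]⟩, ?_⟩
        have : t / 2 ≤ 1 / 2 := by linarith [ht.2]
        simp only [this, if_true]; congr 1; ring
      · rcases eq_or_lt_of_le ht.1 with h0 | h0
        · refine ⟨1/2, ⟨by norm_num, by norm_num⟩, ?_⟩
          simp [← h0, hb, hb']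
        · refine ⟨(t + 1) / 2, ⟨by linarith [ht.1], by linarith [ht.2]⟩, ?_⟩
          have : ¬ (t + 1) / 2 ≤ 1 / 2 := by linarith [ht.2]
          simp only [this, if_false]; congr 1; ring

lemma IsArc.sub {γ : ℝ → E} (h1 : ContinuousOn γ (Icc 0 1)) (h2 : InjOn γ (Icc 0 1)) {s t : ℝ}
    (hs : 0 ≤ s) (hst : s < t) (ht : t ≤ 1) : IsArc (γ '' Icc s t) (γ s) (γ t) := by
  have hp : 0 < t - s := by linarith
  have hm : MapsTo (fun x : ℝ => s + (t - s) * x) (Icc 0 1) (Icc 0 1) := by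
    intro x hx; simp at hx ⊢; constructor <;> nlinarith
  refine ⟨fun x => γ (s + (t - s) * x), h1.comp (by fun_prop) hm, ?_, ?_, by simp, by simp⟩
  · intro x hx y hy hxy
    have := h2 (hm hx) (hm hy) hxy
    have : (t - s) * x = (t - s) * y := by linarith
    exact mul_left_cancel₀ hp.ne' this
  · ext x
    constructor
    · rintro ⟨y, hy, rfl⟩
      exact ⟨_, ⟨by nlinarith [hy.1], by nlinarith [hy.2]⟩, rfl⟩
    · rintro ⟨y, hy, rfl⟩
      refine ⟨(y - s) / (t - s), ⟨div_nonneg (by linarith [hy.1]) hp.le,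
        (div_le_one hp).2 (by linarith [hy.2])⟩, ?_⟩
      simp only
      congr 1
      field_simp; ring

lemma open_arc_eq {γ : ℝ → E} (h2 : InjOn γ (Icc 0 1)) :
    γ '' Icc 0 1 \ {γ 0, γ 1} = γ '' Ioo 0 1 := by
  ext x
  constructor
  · rintro ⟨⟨t, ht, rfl⟩, hx⟩
    simp only [mem_insert_iff, mem_singleton_iff, not_or] at hx
    refine ⟨t, ⟨lt_of_le_of_ne ht.1 ?_, lt_of_le_of_ne ht.2 ?_⟩, rfl⟩
    · rintro rfl; exact hx.1 rfl
    · rintro rfl; exact hx.2 rfl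
  · rintro ⟨t, ht, rfl⟩
    have ht' : t ∈ Icc (0:ℝ) 1 := ⟨ht.1.le, ht.2.le⟩
    refine ⟨⟨t, ht', rfl⟩, ?_⟩
    simp only [mem_insert_iff, mem_singleton_iff, not_or]
    constructor
    · intro h; exact ht.1.ne' (h2 ht' (by simp) h)
    · intro h; exact ht.2.ne (h2 ht' (by simp) h)

lemma IsArc.open_preconn (h : IsArc A a b) : IsPreconnected (A \ {a, b}) := by
  obtain ⟨γ, h1, h2, rfl, rfl, rfl⟩ := h
  rw [open_arc_eq h2]
  exact isPreconnected_Ioo.image _ (h1.mono Ioo_subset_Icc_self)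

lemma IsArc.half_preconn (h : IsArc A a b) : IsPreconnected (A \ {b}) := by
  obtain ⟨γ, h1, h2, rfl, rfl, rfl⟩ := h
  have : γ '' Icc 0 1 \ {γ 1} = γ '' Ico 0 1 := by
    ext x
    constructor
    · rintro ⟨⟨t, ht, rfl⟩, hx⟩
      refine ⟨t, ⟨ht.1, lt_of_le_of_ne ht.2 ?_⟩, rfl⟩
      rintro rfl; exact hx rfl
    · rintro ⟨t, ht, rfl⟩
      have ht' : t ∈ Icc (0:ℝ) 1 := ⟨ht.1, ht.2.le⟩
      exact ⟨⟨t, ht', rfl⟩, fun h => ht.2.ne (h2 ht' (by simp) h)⟩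
  rw [this]
  exact isPreconnected_Ico.image _ (h1.mono Ico_subset_Icc_self)

lemma IsArc.joined (h : IsArc A a b) : JoinedIn A a b := by
  obtain ⟨γ, h1, h2, rfl, rfl, rfl⟩ := h
  exact JoinedIn.ofLine h1 rfl rfl (subset_refl _)

lemma IsArc.map {F : Type*} [TopologicalSpace F] (φ : E → F) (hφ : Continuous φ)
    (hi : Function.Injective φ) (h : IsArc A a b) : IsArc (φ '' A) (φ a) (φ b) := by
  obtain ⟨γ, h1, h2, rfl, rfl, rfl⟩ := h
  exact ⟨φ ∘ γ, hφ.comp_continuousOn h1, fun x hx y hy h => h2 hx hy (hi h), by rw [image_comp],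
    rfl, rfl⟩
end

lemma IsArc.hasLog {A : Set ℂ} {a b : ℂ} (h : IsArc A a b) (f : ℂ → ℂ) (hf : ContinuousOn f A)
    (hne : ∀ z ∈ A, f z ≠ 0) : HasLog A f := by
  obtain ⟨γ, h1, h2, rfl, rfl, rfl⟩ := h
  have c1 : Continuous ((Icc (0:ℝ) 1).domRestrict γ) := continuousOn_iff_continuous_domRestrict.1 h1
  have ce : Topology.IsClosedEmbedding ((Icc (0:ℝ) 1).domRestrict γ) :=
    c1.isClosedEmbedding (injOn_iff_injective.1 h2)
  have hr : range ((Icc (0:ℝ) 1).domRestrict γ) = γ '' Icc 0 1 := by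
    ext x; simp [Set.domRestrict]
  rw [← hr] at hf hne ⊢
  let e := ce.isEmbedding.toHomeomorph
  have he : ∀ y, (e (e.symm y) : ℂ) = y := fun y => by simp
  have he' : ∀ y, γ (e.symm y) = y := fun y => he y
  let m : unitInterval × range ((Icc (0:ℝ) 1).domRestrict γ) → range ((Icc (0:ℝ) 1).domRestrict γ) :=
    fun x => e (x.1 * e.symm x.2)
  have hm : Continuous m := by fun_prop
  refine lift_hom_on _ (fun x => f (m x)) ?_ ?_ (fun _ => log (f (γ 0))) (by fun_prop) ?_ f ?_
  · exact hf.comp_continuous (by fun_prop) (fun x => (m x).2)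
  · intro x; exact hne _ (m x).2
  · intro x
    have h0 : ((m (0, x) : range ((Icc (0:ℝ) 1).domRestrict γ)) : ℂ) = γ 0 := by
      simp only [m]
      rw [zero_mul]; rfl
    simp only [h0]
    rw [exp_log]
    rw [← h0]; exact hne _ (m _).2
  · intro x
    simp [m]

lemma IsArc.ns {A : Set ℂ} {a b : ℂ} (h : IsArc A a b) {p q : ℂ} (hp : p ∉ A) (hq : q ∉ A) :
    NS A p q := by
  have h1 : ∀ x ∉ A, ∀ z ∈ A, z - x ≠ 0 := by
    intro x hx z hz h; exact hx (by rwa [← sub_eq_zero.1 h])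
  refine ns_of_log h.compact hp hq (h.hasLog _ ?_ ?_)
  · exact ContinuousOn.div (by fun_prop) (by fun_prop) (h1 q hq)
  · intro z hz; exact div_ne_zero (h1 p hp z hz) (h1 q hq z hz)

lemma no_log_two {a b : ℂ} (hab : a ≠ b) : ¬ HasLog {a, b}ᶜ (fun z => (z - a) / (z - b)) := by
  rintro ⟨g, hg, hge⟩
  set r := ‖a - b‖ / 2 with hr
  have hd : 0 < ‖a - b‖ := norm_pos_iff.2 (sub_ne_zero.2 hab)
  have hr0 : 0 < r := by positivity
  have hsl : ∀ z ∈ Metric.sphere a r, (z - b) / (a - b) ∈ slitPlane := by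
    intro z hz
    have h1 : (z - b) / (a - b) = 1 + (z - a) / (a - b) := by
      have : a - b ≠ 0 := sub_ne_zero.2 hab
      field_simp; ring
    have h2 : ‖(z - a) / (a - b)‖ < 1 := by
      rw [norm_div]
      have : ‖z - a‖ = r := by simpa [dist_eq_norm] using hz
      rw [this, hr, div_lt_one hd]; linarith
    rw [h1]
    exact mem_slitPlane_of_norm_lt_one h2
  have hmem : ∀ z ∈ Metric.sphere a r, z ∈ ({a, b} : Set ℂ)ᶜ := by
    intro z hz
    simp only [mem_compl_iff, mem_insert_iff, mem_singleton_iff, not_or]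
    constructor
    · rintro rfl; simp at hz; linarith
    · rintro rfl
      have : z ∈ Metric.sphere a r ∧ ‖z - a‖ = r := ⟨hz, by simpa [dist_eq_norm] using hz⟩
      rw [norm_sub_rev] at this
      linarith [this.2]
  refine no_log_circle a r hr0 ⟨fun z => g z + log ((z - b) / (a - b)) + log (a - b), ?_, ?_⟩
  · refine ContinuousOn.add (ContinuousOn.add (hg.mono ?_) ?_) continuousOn_const
    · intro z hz; exact hmem z hz
    · exact ContinuousOn.clog (by fun_prop) hsl
  · intro z hz
    have hz' := hmem z hz
    simp only [mem_compl_iff, mem_insert_iff, mem_singleton_iff, not_or] at hz'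
    have h1 : z - b ≠ 0 := sub_ne_zero.2 hz'.2
    have h2 : a - b ≠ 0 := sub_ne_zero.2 hab
    rw [exp_add, exp_add, hge z (hmem z hz), exp_log h2, exp_log (div_ne_zero h1 h2)]
    field_simp

lemma jordan_sep {A B : Set ℂ} {a b : ℂ} (hA : IsArc A a b) (hB : IsArc B a b)
    (hAB : A ∩ B ⊆ {a, b}) : ∃ p q, p ∉ A ∪ B ∧ q ∉ A ∪ B ∧ ¬ NS (A ∪ B) p q := by
  by_contra hcon
  push Not at hcon
  have hpre : IsPreconnected (Aᶜ ∩ Bᶜ) := by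
    rw [← compl_union]
    refine isPreconnected_of_forall_pair ?_
    intro x hx y hy
    obtain ⟨S, h1, h2, h3, h4⟩ := hcon x y hx hy
    exact ⟨S, h4, h2, h3, h1⟩
  have := log_glue (log_of_joined hA.joined) (log_of_joined hB.joined) hpre
    (Or.inl ⟨hA.compact.isClosed.isOpen_compl, hB.compact.isClosed.isOpen_compl⟩)
  refine no_log_two hA.ne ?_
  obtain ⟨g, hg, hge⟩ := this
  have hs : ({a, b} : Set ℂ)ᶜ ⊆ Aᶜ ∪ Bᶜ := by
    rw [← compl_inter]; exact compl_subset_compl.2 hAB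
  exact ⟨g, hg.mono hs, fun z hz => hge z (hs hz)⟩
end Whit

namespace Whit
open Set Complex

lemma comp_frontier {X : Set ℂ} (hX : IsClosed X) (p : ℂ) :
    frontier (connectedComponentIn Xᶜ p) ⊆ X := by
  intro z hz
  by_contra hzX
  have hUo : IsOpen (connectedComponentIn Xᶜ p) := hX.isOpen_compl.connectedComponentIn
  have hzU : z ∉ connectedComponentIn Xᶜ p := by
    rw [hUo.frontier_eq] at hz; exact hz.2
  have ho : IsOpen (connectedComponentIn Xᶜ z) := hX.isOpen_compl.connectedComponentIn
  obtain ⟨y, hy1, hy2⟩ := mem_closure_iff.1 hz.1 _ ho (mem_connectedComponentIn hzX)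
  apply hzU
  rw [connectedComponentIn_eq hy2, ← connectedComponentIn_eq hy1]
  exact mem_connectedComponentIn hzX

lemma preconn_union_closure {S T : Set ℂ} (hS : IsPreconnected S) (hT : IsPreconnected T) {x : ℂ}
    (hx : x ∈ closure S) (hxT : x ∈ T) : IsPreconnected (S ∪ T) := by
  have h1 : IsPreconnected (insert x S) :=
    hS.subset_closure (subset_insert _ _) (insert_subset hx subset_closure)
  have h2 := h1.union x (mem_insert _ _) hxT hT
  have : insert x S ∪ T = S ∪ T := by
    ext y; simp only [mem_union, mem_insert_iff]
    constructor
    · rintro ((rfl | h) | h)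
      exacts [Or.inr hxT, Or.inl h, Or.inr h]
    · rintro (h | h)
      exacts [Or.inl (Or.inr h), Or.inr h]
  rwa [this] at h2

lemma NS.trans {X : Set ℂ} {p q r : ℂ} (h : NS X p q) (h' : NS X q r) : NS X p r := by
  obtain ⟨S, a, b, c, d⟩ := h
  obtain ⟨S', a', b', c', d'⟩ := h'
  exact ⟨S ∪ S', a.union q c b' a', Or.inl b, Or.inr c', union_subset d d'⟩

lemma closure_meets {X Y : Set ℂ} (hX : IsClosed X) {a b p q : ℂ} (hY : IsArc Y a b) (hYX : Y ⊆ X)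
    (hp : p ∉ X) (hq : q ∉ X) (hn : ¬ NS X p q) :
    ∃ z ∈ X \ Y, z ∈ closure (connectedComponentIn Xᶜ p) := by
  obtain ⟨S, h1, h2, h3, h4⟩ := hY.ns (fun h => hp (hYX h)) (fun h => hq (hYX h))
  have hqD : q ∉ connectedComponentIn Xᶜ p := fun h =>
    hn ⟨_, isPreconnected_connectedComponentIn, mem_connectedComponentIn hp, h,
      connectedComponentIn_subset _ _⟩
  obtain ⟨z, hz1, hz2⟩ : (S ∩ frontier (connectedComponentIn Xᶜ p)).Nonempty := by
    by_contra hne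
    have hUo : IsOpen (connectedComponentIn Xᶜ p) := hX.isOpen_compl.connectedComponentIn
    have hnf : ∀ z ∈ S, z ∈ closure (connectedComponentIn Xᶜ p) → z ∈ connectedComponentIn Xᶜ p := by
      intro z hz hzc
      by_contra hzn
      exact hne ⟨z, hz, by rw [hUo.frontier_eq]; exact ⟨hzc, hzn⟩⟩
    obtain ⟨z, -, hz1, hz2⟩ := h1 _ _ hUo (isClosed_closure (s := connectedComponentIn Xᶜ p)).isOpen_compl
      (by
        intro z hz
        by_cases hzc : z ∈ closure (connectedComponentIn Xᶜ p)
        · exact Or.inl (hnf z hz hzc)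
        · exact Or.inr hzc)
      ⟨p, h2, mem_connectedComponentIn hp⟩ ⟨q, h3, fun h => hqD (hnf q h3 h)⟩
    exact hz2 (subset_closure hz1)
  exact ⟨z, ⟨comp_frontier hX p hz2, h4 hz1⟩, hz2.1⟩

lemma jordan_closure {A B : Set ℂ} {a b p q : ℂ} (hA : IsArc A a b) (hB : IsArc B a b)
    (hAB : A ∩ B ⊆ {a, b}) (hp : p ∉ A ∪ B) (hq : q ∉ A ∪ B) (hn : ¬ NS (A ∪ B) p q) :
    A ⊆ closure (connectedComponentIn (A ∪ B)ᶜ p) := by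
  intro x hx
  by_contra hxc
  have hcl : IsClosed (A ∪ B) := (hA.compact.union hB.compact).isClosed
  obtain ⟨γ, h1, h2, h3, h4, h5⟩ := hA
  rw [← h3] at hx
  obtain ⟨t, ht, rfl⟩ := hx
  have hnb : (closure (connectedComponentIn (A ∪ B)ᶜ p))ᶜ ∈ nhds (γ t) :=
    isClosed_closure.isOpen_compl.mem_nhds hxc
  have := h1 t ht hnb
  rw [Filter.mem_map, Metric.mem_nhdsWithin_iff] at this
  obtain ⟨δ, hδ, hsub⟩ := this
  have hlt : max 0 (t - δ) < min 1 (t + δ) := by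
    rw [max_lt_iff, lt_min_iff, lt_min_iff]
    refine ⟨⟨by norm_num, by linarith [ht.1]⟩, ⟨by linarith [ht.2], by linarith⟩⟩
  obtain ⟨t2, h21, h22⟩ := exists_between hlt
  obtain ⟨t1, h11, h12⟩ := exists_between h21
  rw [max_lt_iff] at h11 h21
  rw [lt_min_iff] at h22
  have I1 : IsArc (γ '' Icc 0 t1) (γ 0) (γ t1) := IsArc.sub h1 h2 le_rfl h11.1 (by linarith)
  have I2 : IsArc (γ '' Icc t2 1) (γ t2) (γ 1) := IsArc.sub h1 h2 h21.1.le h22.1 le_rfl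
  rw [h4] at I1
  rw [h5] at I2
  have s1 : γ '' Icc 0 t1 ⊆ A := by
    rw [← h3]; exact image_mono (Icc_subset_Icc le_rfl (by linarith))
  have s2 : γ '' Icc t2 1 ⊆ A := by
    rw [← h3]; exact image_mono (Icc_subset_Icc h21.1.le le_rfl)
  have J1 := I2.trans hB.symm (by
    rintro z ⟨hz1, hz2⟩
    rcases hAB ⟨s2 hz1, hz2⟩ with rfl | h
    · obtain ⟨s, hs, hs'⟩ := hz1
      rw [← h4] at hs'
      have := h2 ⟨by linarith [hs.1], hs.2⟩ (by simp) hs'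
      linarith [hs.1]
    · exact h)
  have J2 := J1.trans I1 (by
    rintro z ⟨hz1 | hz1, hz2⟩
    · obtain ⟨s, hs, rfl⟩ := hz1
      obtain ⟨s', hs', he⟩ := hz2
      have := h2 ⟨hs'.1, by linarith [hs'.2]⟩ ⟨by linarith [hs.1], hs.2⟩ he
      linarith [hs.1, hs'.2]
    · rcases hAB ⟨s1 hz2, hz1⟩ with h | rfl
      · exact h
      · obtain ⟨s, hs, hs'⟩ := hz2
        rw [← h5] at hs'
        have := h2 ⟨hs.1, by linarith [hs.2]⟩ (by simp) hs'
        linarith [hs.2])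
  obtain ⟨z, ⟨hz1, hz2⟩, hz3⟩ := closure_meets hcl J2 (by
    rintro z ((h | h) | h)
    exacts [Or.inl (s2 h), Or.inr h, Or.inl (s1 h)]) hp hq hn
  rcases hz1 with hz1 | hz1
  · rw [← h3] at hz1
    obtain ⟨s, hs, rfl⟩ := hz1
    by_cases c1 : s ≤ t1
    · exact hz2 (Or.inr ⟨s, ⟨hs.1, c1⟩, rfl⟩)
    by_cases c2 : t2 ≤ s
    · exact hz2 (Or.inl (Or.inl ⟨s, ⟨c2, hs.2⟩, rfl⟩))
    push Not at c1 c2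
    refine hsub ⟨?_, hs⟩ hz3
    rw [Metric.mem_ball, Real.dist_eq, abs_lt]
    constructor <;> linarith
  · exact hz2 (Or.inl (Or.inr hz1))

lemma theta {A₁ A₂ A₃ F : Set ℂ} {a b x₁ x₂ x₃ : ℂ} (h1 : IsArc A₁ a b) (h2 : IsArc A₂ a b)
    (h3 : IsArc A₃ a b) (h12 : A₁ ∩ A₂ ⊆ {a, b}) (h13 : A₁ ∩ A₃ ⊆ {a, b}) (h23 : A₂ ∩ A₃ ⊆ {a, b})
    (hF : IsPreconnected F) (hF1 : Disjoint F A₁) (hF2 : Disjoint F A₂) (hF3 : Disjoint F A₃)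
    (hx1 : x₁ ∈ A₁ \ {a, b}) (hx2 : x₂ ∈ A₂ \ {a, b}) (hx3 : x₃ ∈ A₃ \ {a, b})
    (hc1 : x₁ ∈ closure F) (hc2 : x₂ ∈ closure F) (hc3 : x₃ ∈ closure F) : False := by
  have hx3' : x₃ ∉ A₁ ∪ A₂ := by
    rintro (h | h)
    · exact hx3.2 (h13 ⟨h, hx3.1⟩)
    · exact hx3.2 (h23 ⟨h, hx3.1⟩)
  obtain ⟨p, hp, hpn⟩ : ∃ p, p ∉ A₁ ∪ A₂ ∧ ¬ NS (A₁ ∪ A₂) p x₃ := by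
    obtain ⟨p, q, hp, hq, hn⟩ := jordan_sep h1 h2 h12
    by_cases h : NS (A₁ ∪ A₂) p x₃
    · exact ⟨q, hq, fun h' => hn (h.trans h'.symm)⟩
    · exact ⟨p, hp, h⟩
  have c1 := jordan_closure h1 h2 h12 hp hx3' hpn
  have c2 : A₂ ⊆ closure (connectedComponentIn (A₁ ∪ A₂)ᶜ p) := by
    rw [union_comm] at hp hx3' hpn ⊢
    rw [inter_comm] at h12
    exact jordan_closure h2 h1 h12 hp hx3' hpn
  set D := connectedComponentIn (A₁ ∪ A₂)ᶜ p with hD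
  have hDc : IsPreconnected D := isPreconnected_connectedComponentIn
  have hpD : p ∈ D := mem_connectedComponentIn hp
  have hDs : D ⊆ (A₁ ∪ A₂)ᶜ := connectedComponentIn_subset _ _
  have hab3 : ∀ z ∈ ({a, b} : Set ℂ), z ∈ A₁ := by
    rintro z (rfl | rfl); exacts [h1.left, h1.right]
  have hD3 : ∀ z ∈ D, z ∉ A₃ := by
    intro z hz hz3
    have hz' : z ∈ A₃ \ {a, b} := ⟨hz3, fun h => hDs hz (Or.inl (hab3 z h))⟩
    refine hpn ⟨D ∪ A₃ \ {a, b}, hDc.union z hz hz' h3.open_preconn, Or.inl hpD, Or.inr hx3, ?_⟩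
    refine union_subset hDs ?_
    rintro y hy (h | h)
    · exact hy.2 (h13 ⟨h, hy.1⟩)
    · exact hy.2 (h23 ⟨h, hy.1⟩)
  obtain ⟨q, hq⟩ : F.Nonempty := closure_nonempty_iff.1 ⟨_, hc1⟩
  have dF1 := fun z (hz : z ∈ F) => disjoint_left.1 hF1 hz
  have dF2 := fun z (hz : z ∈ F) => disjoint_left.1 hF2 hz
  have dF3 := fun z (hz : z ∈ F) => disjoint_left.1 hF3 hz
  have n1 : NS (A₁ ∪ A₃) q p := by
    refine ⟨(F ∪ A₂ \ {a, b}) ∪ (D ∪ A₂ \ {a, b}), IsPreconnected.union x₂ (Or.inr hx2) (Or.inr hx2)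
      (preconn_union_closure hF h2.open_preconn hc2 hx2)
      (preconn_union_closure hDc h2.open_preconn (c2 hx2.1) hx2), Or.inl (Or.inl hq),
      Or.inr (Or.inl hpD), ?_⟩
    rintro y ((hy | hy) | (hy | hy)) (h | h)
    · exact dF1 y hy h
    · exact dF3 y hy h
    · exact hy.2 (h12 ⟨h, hy.1⟩)
    · exact hy.2 (h23 ⟨hy.1, h⟩)
    · exact hDs hy (Or.inl h)
    · exact hD3 y hy h
    · exact hy.2 (h12 ⟨h, hy.1⟩)
    · exact hy.2 (h23 ⟨hy.1, h⟩)
  have n2 : NS (A₂ ∪ A₃) q p := by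
    refine ⟨(F ∪ A₁ \ {a, b}) ∪ (D ∪ A₁ \ {a, b}), IsPreconnected.union x₁ (Or.inr hx1) (Or.inr hx1)
      (preconn_union_closure hF h1.open_preconn hc1 hx1)
      (preconn_union_closure hDc h1.open_preconn (c1 hx1.1) hx1), Or.inl (Or.inl hq),
      Or.inr (Or.inl hpD), ?_⟩
    rintro y ((hy | hy) | (hy | hy)) (h | h)
    · exact dF2 y hy h
    · exact dF3 y hy h
    · exact hy.2 (h12 ⟨hy.1, h⟩)
    · exact hy.2 (h13 ⟨hy.1, h⟩)
    · exact hDs hy (Or.inr h)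
    · exact hD3 y hy h
    · exact hy.2 (h12 ⟨hy.1, h⟩)
    · exact hy.2 (h13 ⟨hy.1, h⟩)
  have hint : (A₁ ∪ A₃) ∩ (A₂ ∪ A₃) = A₃ := by
    rw [← inter_union_distrib_right]
    apply union_eq_self_of_subset_left
    refine h12.trans ?_
    rintro z (rfl | rfl); exacts [h3.left, h3.right]
  obtain ⟨S, s1, s2, s3, s4⟩ := janiszewski (h1.compact.union h3.compact)
    (h2.compact.union h3.compact) (by rw [hint]; exact h3.preconn) n1 n2
  refine hpn ⟨(S ∪ F) ∪ {x₃}, preconn_union_closure (s1.union q s2 hq hF) isPreconnected_singleton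
    (closure_mono subset_union_right hc3) rfl, Or.inl (Or.inl s3), Or.inr rfl, ?_⟩
  rintro y ((hy | hy) | rfl)
  · rintro (h | h)
    · exact s4 hy (Or.inl (Or.inl h))
    · exact s4 hy (Or.inr (Or.inl h))
  · rintro (h | h)
    · exact dF1 y hy h
    · exact dF2 y hy h
  · exact hx3'
end Whit

namespace Whit
open SimpleGraph

section
variable {V : Type} {G : SimpleGraph V}

lemma path_first {p n : V} (P : G.Walk p n) (hP : P.IsPath) (S : Set V) (hn : n ∈ S) :
    ∃ s ∈ S, ∃ (A : G.Walk p s) (B : G.Walk s n), A.IsPath ∧ B.IsPath ∧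
      (∀ x, x ∈ P.support ↔ x ∈ A.support ∨ x ∈ B.support) ∧
      (∀ x, x ∈ A.support → x ∈ B.support → x = s) ∧
      (∀ e, e ∈ P.edges ↔ e ∈ A.edges ∨ e ∈ B.edges) ∧
      (∀ x ∈ A.support, x ∈ S → x = s) := by
  induction P with
  | nil => exact ⟨_, hn, .nil, .nil, by simp, by simp, by simp, by simp, by simp, by simp⟩
  | @cons u v w h P ih =>
    by_cases hu : u ∈ S
    · exact ⟨u, hu, .nil, .cons h P, by simp, hP, by simp, by simp, by simp, by simp⟩
    · rw [Walk.cons_isPath_iff] at hP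
      obtain ⟨s, hs, A, B, hA, hB, h1, h2, h3, h4⟩ := ih hP.1 hn
      refine ⟨s, hs, .cons h A, B, ?_, hB, ?_, ?_, ?_, ?_⟩
      · rw [Walk.cons_isPath_iff]; exact ⟨hA, fun h => hP.2 ((h1 _).2 (Or.inl h))⟩
      · intro x; simp [h1, or_assoc]
      · intro x hx hxB
        simp at hx
        rcases hx with rfl | hx
        · exact absurd ((h1 _).2 (Or.inr hxB)) hP.2
        · exact h2 x hx hxB
      · intro e; simp [h3, or_assoc]
      · intro x hx hxS
        simp at hx
        rcases hx with rfl | hx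
        · exact absurd hxS hu
        · exact h4 x hx hxS

lemma path_split {p n u : V} (P : G.Walk p n) (hP : P.IsPath) (hu : u ∈ P.support) :
    ∃ (A : G.Walk p u) (B : G.Walk u n), A.IsPath ∧ B.IsPath ∧
      (∀ x, x ∈ P.support ↔ x ∈ A.support ∨ x ∈ B.support) ∧
      (∀ x, x ∈ A.support → x ∈ B.support → x = u) ∧
      (∀ e, e ∈ P.edges ↔ e ∈ A.edges ∨ e ∈ B.edges) := by
  classical
  have hs := P.take_spec hu
  have hP' := hP
  rw [← hs] at hP'
  refine ⟨P.takeUntil u hu, P.dropUntil u hu, hP.takeUntil hu, hP.dropUntil hu, ?_, ?_, ?_⟩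
  · intro x; rw [← Walk.mem_support_append_iff, hs]
  · intro x hx hy
    rw [Walk.isPath_def, Walk.support_append, List.nodup_append] at hP'
    by_contra hne
    refine hP'.2.2 x hx x ?_ rfl
    rcases (Walk.mem_support_iff _).1 hy with h | h
    · exact absurd h hne
    · exact h
  · intro e; rw [← List.mem_append, ← Walk.edges_append, hs]

lemma path_join {s u t : V} (A : G.Walk s u) (B : G.Walk u t) (hA : A.IsPath) (hB : B.IsPath)
    (h : ∀ x, x ∈ A.support → x ∈ B.support → x = u) :
    ∃ R : G.Walk s t, R.IsPath ∧ (∀ x, x ∈ R.support ↔ x ∈ A.support ∨ x ∈ B.support) ∧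
      (∀ e, e ∈ R.edges ↔ e ∈ A.edges ∨ e ∈ B.edges) := by
  refine ⟨A.append B, ?_, by simp, by simp⟩
  rw [Walk.isPath_def, Walk.support_append, List.nodup_append]
  have hB2 := hB.support_nodup
  rw [Walk.support_eq_cons, List.nodup_cons] at hB2
  refine ⟨hA.support_nodup, hB2.2, ?_⟩
  rintro x hx y hy rfl
  have := h x hx (List.mem_of_mem_tail hy)
  subst this
  exact hB2.1 hy

lemma first_hit {x y : V} (W : G.Walk x y) (S : Set V) (hy : y ∈ S) :
    ∃ s ∈ S, ∃ R : G.Walk x s, R.IsPath ∧ (∀ z ∈ R.support, z ∈ W.support) ∧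
      (∀ z ∈ R.support, z ∈ S → z = s) := by
  classical
  obtain ⟨s, hs, A, B, hA, -, h1, -, -, h4⟩ := path_first W.bypass W.bypass_isPath S hy
  exact ⟨s, hs, A, hA, fun z hz => W.support_bypass_subset_support ((h1 z).2 (Or.inl hz)), h4⟩

lemma path_edge_ends {x y : V} (P : G.Walk x y) (hP : P.IsPath) (h : s(x, y) ∈ P.edges) :
    ∀ t ∈ P.support, t = x ∨ t = y := by
  cases P with
  | nil => simp
  | @cons _ v _ h' P =>
    rw [Walk.cons_isPath_iff] at hP
    simp only [Walk.edges_cons, List.mem_cons] at h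
    rcases h with h | h
    · have : y = v := by
        have := h'.ne
        simp at h; grind
      subst this
      have := Walk.isPath_iff_eq_nil.1 hP.1
      subst this
      simp
    · exact absurd (Walk.fst_mem_support_of_mem_edges _ h) hP.2

lemma path_interior {s t : V} (P : G.Walk s t) (hst : s ≠ t) :
    s(s, t) ∈ P.edges ∨ ∃ x ∈ P.support, x ≠ s ∧ x ≠ t := by
  cases P with
  | nil => exact absurd rfl hst
  | @cons _ v _ h P =>
    by_cases hv : v = t
    · subst hv; left; simp
    · right; exact ⟨v, by simp, h.ne', hv⟩

lemma path_head {s t : V} (P : G.Walk s t) (hP : P.IsPath) :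
    ∃ x, ∀ y, s(s, y) ∈ P.edges → y = x := by
  cases P with
  | nil => exact ⟨s, by simp⟩
  | @cons _ v _ h P =>
    rw [Walk.cons_isPath_iff] at hP
    refine ⟨v, fun y hy => ?_⟩
    simp only [Walk.edges_cons, List.mem_cons] at hy
    rcases hy with hy | hy
    · have := h.ne
      simp at hy; grind
    · exact absurd (Walk.fst_mem_support_of_mem_edges _ hy) hP.2

/-- a path with s ≠ t has an edge -/
lemma path_edge {s t : V} (P : G.Walk s t) (hst : s ≠ t) : ∃ e, e ∈ P.edges := by
  cases P with
  | nil => exact absurd rfl hst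
  | @cons _ v _ h P => exact ⟨s(s, v), by simp⟩

lemma cycle_split {a s t : V} (w : G.Walk a a) (hw : w.IsCycle) (hs : s ∈ w.support)
    (ht : t ∈ w.support) (hst : s ≠ t) :
    ∃ P1 P2 : G.Walk s t, P1.IsPath ∧ P2.IsPath ∧
      (∀ x, x ∈ w.support ↔ x ∈ P1.support ∨ x ∈ P2.support) ∧
      (∀ x, x ∈ P1.support → x ∈ P2.support → x = s ∨ x = t) ∧
      (∀ e, e ∈ w.edges ↔ e ∈ P1.edges ∨ e ∈ P2.edges) ∧
      (∀ e, e ∈ P1.edges → e ∉ P2.edges) := by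
  classical
  set c := w.rotate s hs with hc
  have hcy : c.IsCycle := hw.rotate hs
  have hsup : ∀ x, x ∈ w.support ↔ x ∈ c.support := fun x => by
    rw [hc]; simp
  have hed : ∀ e, e ∈ w.edges ↔ e ∈ c.edges := fun e => (w.rotate_edges s hs).mem_iff.symm
  have ht' : t ∈ c.support := (hsup t).1 ht
  have hsp := c.take_spec ht'
  have hnd := hcy.support_nodup
  rw [← hsp, Walk.tail_support_append, List.nodup_append] at hnd
  have key : ∀ x, x ∈ (c.takeUntil t ht').support → x ∈ (c.dropUntil t ht').support →
      x = s ∨ x = t := by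
    intro x h1 h2
    rcases (Walk.mem_support_iff _).1 h1 with h1 | h1
    · exact Or.inl h1
    rcases (Walk.mem_support_iff _).1 h2 with h2 | h2
    · exact Or.inr h2
    exact absurd rfl (hnd.2.2 x h1 x h2)
  have hp2 : (c.dropUntil t ht').IsPath := by
    rw [Walk.isPath_def, Walk.support_eq_cons, List.nodup_cons]
    refine ⟨fun h => ?_, hnd.2.1⟩
    refine hnd.2.2 t ?_ t h rfl
    rcases (Walk.mem_support_iff _).1 (c.takeUntil t ht').end_mem_support with h | h
    · exact absurd h hst.symm
    · exact h
  refine ⟨c.takeUntil t ht', (c.dropUntil t ht').reverse, hcy.isPath_takeUntil ht', hp2.reverse,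
    ?_, ?_, ?_, ?_⟩
  · intro x; rw [hsup, Walk.support_reverse, List.mem_reverse, ← Walk.mem_support_append_iff, hsp]
  · intro x h1 h2; exact key x h1 (by simpa using h2)
  · intro e; rw [hed, Walk.edges_reverse, List.mem_reverse, ← List.mem_append, ← Walk.edges_append, hsp]
  · intro e h1 h2
    rw [Walk.edges_reverse, List.mem_reverse] at h2
    have := hcy.isTrail
    have := this.disjoint_edges_takeUntil_dropUntil ht'
    exact this h1 h2

lemma reach_of_conn {S : Set V} (h : (G.induce Sᶜ).Connected) {x y : V} (hx : x ∉ S) (hy : y ∉ S) :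
    ∃ W : G.Walk x y, ∀ z ∈ W.support, z ∉ S := by
  obtain ⟨W⟩ := h.preconnected ⟨x, hx⟩ ⟨y, hy⟩
  have key : ∀ (p q : (Sᶜ : Set V)) (W : (G.induce Sᶜ).Walk p q), ∃ W' : G.Walk p.1 q.1,
      ∀ z ∈ W'.support, z ∉ S := by
    intro p q W
    induction W with
    | @nil u => exact ⟨.nil, by intro z hz; simp at hz; subst hz; exact u.2⟩
    | @cons u v w h W ih =>
      obtain ⟨W', hW'⟩ := ih
      have h' : G.Adj u.1 v.1 := h
      refine ⟨.cons h' W', ?_⟩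
      simp only [Walk.support_cons, List.mem_cons]
      rintro z (rfl | hz)
      · exact u.2
      · exact hW' z hz
  exact key _ _ W

end
end Whit

namespace Whit

section
open Set Complex

lemma jordan_C {A B : Set ℂ} {a b x : ℂ} (hA : IsArc A a b) (hB : IsArc B a b)
    (hAB : A ∩ B ⊆ {a, b}) (hx : x ∉ A ∪ B) :
    ∃ p, p ∉ A ∪ B ∧ p ∉ connectedComponentIn (A ∪ B)ᶜ x ∧
      frontier (connectedComponentIn (A ∪ B)ᶜ p) = A ∪ B := by
  have hcl : IsClosed (A ∪ B) := (hA.compact.union hB.compact).isClosed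
  have key : ∃ p, p ∉ A ∪ B ∧ ¬ NS (A ∪ B) p x := by
    obtain ⟨p, q, hp, hq, hn⟩ := jordan_sep hA hB hAB
    by_cases h : NS (A ∪ B) p x
    · refine ⟨q, hq, fun h' => hn (h.trans h'.symm)⟩
    · exact ⟨p, hp, h⟩
  obtain ⟨p, hp, hn⟩ := key
  refine ⟨p, hp, fun h => hn ⟨_, isPreconnected_connectedComponentIn, h, mem_connectedComponentIn hx,
    connectedComponentIn_subset _ _⟩, ?_⟩
  apply subset_antisymm (comp_frontier hcl p)
  have h1 := jordan_closure hA hB hAB hp hx hn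
  have h2 : B ⊆ closure (connectedComponentIn (A ∪ B)ᶜ p) := by
    rw [union_comm] at hp hx hn ⊢
    exact jordan_closure hB hA (by rwa [inter_comm]) hp hx hn
  have hUo : IsOpen (connectedComponentIn (A ∪ B)ᶜ p) := hcl.isOpen_compl.connectedComponentIn
  rw [hUo.frontier_eq]
  exact fun z hz => ⟨union_subset h1 h2 hz, fun h => connectedComponentIn_subset _ _ h hz⟩

noncomputable def phi : ℝ × ℝ ≃ₜ ℂ := Complex.equivRealProdCLM.symm.toHomeomorph

lemma jordan_R {A B : Set (ℝ × ℝ)} {a b x : ℝ × ℝ} (hA : IsArc A a b) (hB : IsArc B a b)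
    (hAB : A ∩ B ⊆ {a, b}) (hx : x ∉ A ∪ B) :
    ∃ p, p ∉ A ∪ B ∧ p ∉ connectedComponentIn (A ∪ B)ᶜ x ∧
      frontier (connectedComponentIn (A ∪ B)ᶜ p) = A ∪ B := by
  have e : ∀ y, connectedComponentIn (phi '' A ∪ phi '' B)ᶜ (phi y) =
      phi '' connectedComponentIn (A ∪ B)ᶜ y ∨ y ∈ A ∪ B := by
    intro y
    by_cases hy : y ∈ A ∪ B
    · exact Or.inr hy
    · left
      rw [phi.image_connectedComponentIn hy, phi.image_compl, image_union]
  have hx' : phi x ∉ phi '' A ∪ phi '' B := by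
    rw [← image_union, phi.injective.mem_set_image]; exact hx
  obtain ⟨p, hp, h1, h2⟩ := jordan_C (hA.map phi phi.continuous phi.injective)
    (hB.map phi phi.continuous phi.injective)
    (by
      rw [← image_inter phi.injective]
      refine (image_mono hAB).trans ?_
      rw [image_pair]) hx'
  obtain ⟨p, rfl⟩ := phi.surjective p
  have hp' : p ∉ A ∪ B := by
    rwa [← image_union, phi.injective.mem_set_image] at hp
  have ep := (e p).resolve_right hp'
  have ex := (e x).resolve_right hx
  refine ⟨p, hp', ?_, ?_⟩
  · rwa [ex, phi.injective.mem_set_image] at h1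
  · rw [ep, ← phi.image_frontier, ← image_union] at h2
    exact phi.injective.image_injective h2

lemma theta_R {A₁ A₂ A₃ F : Set (ℝ × ℝ)} {a b x₁ x₂ x₃ : ℝ × ℝ} (h1 : IsArc A₁ a b)
    (h2 : IsArc A₂ a b)
    (h3 : IsArc A₃ a b) (h12 : A₁ ∩ A₂ ⊆ {a, b}) (h13 : A₁ ∩ A₃ ⊆ {a, b}) (h23 : A₂ ∩ A₃ ⊆ {a, b})
    (hF : IsPreconnected F) (hF1 : Disjoint F A₁) (hF2 : Disjoint F A₂) (hF3 : Disjoint F A₃)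
    (hx1 : x₁ ∈ A₁ \ {a, b}) (hx2 : x₂ ∈ A₂ \ {a, b}) (hx3 : x₃ ∈ A₃ \ {a, b})
    (hc1 : x₁ ∈ closure F) (hc2 : x₂ ∈ closure F) (hc3 : x₃ ∈ closure F) : False := by
  have i : ∀ X Y : Set (ℝ × ℝ), X ∩ Y ⊆ {a, b} → phi '' X ∩ phi '' Y ⊆ {phi a, phi b} := by
    intro X Y h
    rw [← image_inter phi.injective]
    refine (image_mono h).trans ?_
    rw [image_pair]
  have m : ∀ (X : Set (ℝ × ℝ)) y, y ∈ X \ {a, b} → phi y ∈ phi '' X \ {phi a, phi b} := by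
    intro X y hy
    rw [← image_pair, ← image_diff phi.injective]
    exact mem_image_of_mem _ hy
  have c : ∀ y, y ∈ closure F → phi y ∈ closure (phi '' F) := by
    intro y hy
    rw [← phi.image_closure]
    exact mem_image_of_mem _ hy
  have d : ∀ X, Disjoint F X → Disjoint (phi '' F) (phi '' X) := fun X h =>
    (disjoint_image_iff phi.injective).2 h
  have t : ∀ X, IsArc X a b → IsArc (phi '' X) (phi a) (phi b) := fun X h =>
    h.map phi phi.continuous phi.injective
  exact theta (t _ h1) (t _ h2) (t _ h3) (i _ _ h12) (i _ _ h13) (i _ _ h23)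
    (hF.image _ phi.continuous.continuousOn) (d _ hF1) (d _ hF2) (d _ hF3) (m _ _ hx1) (m _ _ hx2)
    (m _ _ hx3) (c _ hc1) (c _ hc2) (c _ hc3)
end

section
open SimpleGraph
variable {V : Type} {G : SimpleGraph V} (emb : PlanarEmbedding G)

lemma arc_isArc {u v : V} (h : G.Adj u v) : IsArc (emb.arc s(u, v)) (emb.pos u) (emb.pos v) := by
  obtain ⟨γ, h1, h2, h3, h4, h5⟩ := emb.arc_param h
  exact ⟨γ, h1, h2, h3, h4, h5⟩

lemma arc_pt {u v : V} (h : G.Adj u v) : ∃ z ∈ emb.arc s(u, v), z ∉ Set.range emb.pos := by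
  obtain ⟨γ, h1, h2, h3, h4, h5⟩ := emb.arc_param h
  have hh : (1/2 : ℝ) ∈ Set.Icc (0:ℝ) 1 := by norm_num
  refine ⟨γ (1/2), h3 ▸ Set.mem_image_of_mem _ hh, ?_⟩
  rintro ⟨x, hx⟩
  rcases emb.arc_vertex h x (by rw [hx, ← h3]; exact Set.mem_image_of_mem _ hh) with rfl | rfl
  · have := h2 hh (by norm_num) (hx.symm.trans h4.symm); norm_num at this
  · have := h2 hh (by norm_num) (hx.symm.trans h5.symm); norm_num at this

lemma pos_mem_walk {u v x : V} (P : G.Walk u v) : emb.pos x ∈ emb.walkImage P ↔ x ∈ P.support := by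
  constructor
  · rintro (⟨y, hy, h⟩ | h)
    · rw [← emb.pos_inj h]; exact hy
    · simp only [Set.mem_iUnion] at h
      obtain ⟨e, he, h⟩ := h
      induction e with
      | _ y z =>
      rcases emb.arc_vertex (P.adj_of_mem_edges he) x h with rfl | rfl
      · exact P.fst_mem_support_of_mem_edges he
      · exact P.snd_mem_support_of_mem_edges he
  · exact fun h => Or.inl ⟨x, h, rfl⟩

lemma arc_mem_walk {u v : V} (P : G.Walk u v) {e : Sym2 V} (he : e ∈ P.edges) :
    emb.arc e ⊆ emb.walkImage P := by
  intro z hz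
  right
  simp only [Set.mem_iUnion]
  exact ⟨e, he, hz⟩

lemma walk_cap {u v u' v' : V} (P : G.Walk u v) (Q : G.Walk u' v')
    (hd : ∀ e, e ∈ P.edges → e ∉ Q.edges) {z : ℝ × ℝ} (h1 : z ∈ emb.walkImage P)
    (h2 : z ∈ emb.walkImage Q) : ∃ x, x ∈ P.support ∧ x ∈ Q.support ∧ z = emb.pos x := by
  have key : z ∈ Set.range emb.pos := by
    rcases h1 with ⟨y, hy, h⟩ | h1
    · exact ⟨y, h⟩
    rcases h2 with ⟨y, hy, h⟩ | h2
    · exact ⟨y, h⟩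
    simp only [Set.mem_iUnion] at h1 h2
    obtain ⟨e, he, h1⟩ := h1
    obtain ⟨f, hf, h2⟩ := h2
    induction e with
    | _ y z =>
    induction f with
    | _ y' z' =>
    exact emb.arc_inter (P.adj_of_mem_edges he) (Q.adj_of_mem_edges hf)
      (fun h => hd _ he (h ▸ hf)) ⟨h1, h2⟩
  obtain ⟨x, rfl⟩ := key
  exact ⟨x, (pos_mem_walk emb P).1 h1, (pos_mem_walk emb Q).1 h2, rfl⟩

lemma walkImage_image {u v : V} (P : G.Walk u v) : emb.walkImage P ⊆ emb.image := by
  rintro z (⟨y, hy, h⟩ | h)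
  · exact Or.inl ⟨y, h⟩
  · right
    simp only [Set.mem_iUnion] at h ⊢
    obtain ⟨e, he, h⟩ := h
    exact ⟨e, P.edges_subset_edgeSet he, h⟩

lemma walkImage_cons {u v w : V} (h : G.Adj u v) (P : G.Walk v w) :
    emb.walkImage (.cons h P) = emb.arc s(u, v) ∪ emb.walkImage P := by
  ext z
  simp only [PlanarEmbedding.walkImage, Walk.support_cons, Walk.edges_cons, List.mem_cons,
    Set.mem_union, Set.mem_image, Set.mem_setOf_eq, Set.mem_iUnion, exists_prop]
  have := (arc_isArc emb h).left
  constructor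
  · rintro (⟨x, rfl | hx, rfl⟩ | ⟨e, rfl | he, hz⟩) <;> grind
  · rintro (h | ⟨x, hx, rfl⟩ | ⟨e, he, hz⟩) <;> grind

lemma path_isArc {u v : V} (P : G.Walk u v) (hP : P.IsPath) (huv : u ≠ v) :
    IsArc (emb.walkImage P) (emb.pos u) (emb.pos v) := by
  induction P with
  | nil => exact absurd rfl huv
  | @cons u x w h P ih =>
    rw [Walk.cons_isPath_iff] at hP
    rw [walkImage_cons]
    have ha := arc_isArc emb h
    by_cases hxw : x = w
    · subst hxw
      have := Walk.isPath_iff_eq_nil.1 hP.1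
      subst this
      have : emb.arc s(u, x) ∪ emb.walkImage (Walk.nil : G.Walk x x) = emb.arc s(u, x) := by
        apply Set.union_eq_left.2
        rintro z (⟨y, hy, hz⟩ | hz)
        · simp at hy; subst hy; rw [← hz]; exact ha.right
        · simp at hz
      rw [this]; exact ha
    · refine ha.trans (ih hP.1 hxw) ?_
      rintro z ⟨h1, h2⟩
      have : s(u, x) ∉ P.edges := fun h => hP.2 (P.fst_mem_support_of_mem_edges h)
      obtain ⟨y, hy1, hy2, rfl⟩ := walk_cap emb (.cons h (.nil : G.Walk x x)) P (by simpa using this)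
        (arc_mem_walk emb _ (by simp) h1) h2
      simp at hy1
      rcases hy1 with rfl | rfl
      · exact absurd hy2 hP.2
      · rfl

lemma theta_G {a x y : V} (w : G.Walk a a) (hxy : x ≠ y) (Q1 Q2 Q3 : G.Walk x y) (h1 : Q1.IsPath)
    (h2 : Q2.IsPath) (h3 : Q3.IsPath)
    (h12 : ∀ z, z ∈ Q1.support → z ∈ Q2.support → z = x ∨ z = y)
    (h13 : ∀ z, z ∈ Q1.support → z ∈ Q3.support → z = x ∨ z = y)
    (h23 : ∀ z, z ∈ Q2.support → z ∈ Q3.support → z = x ∨ z = y)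
    (i2 : ∃ z ∈ Q2.support, z ≠ x ∧ z ≠ y)
    (i3 : ∃ z ∈ Q3.support, z ≠ x ∧ z ≠ y)
    (F : Set (ℝ × ℝ)) (hF : IsPreconnected F) (hFi : Disjoint F emb.image)
    (hFw : emb.walkImage w ⊆ closure F)
    (c1 : (∃ e ∈ Q1.edges, e ∈ w.edges) ∨ ∃ z ∈ Q1.support, z ∈ w.support ∧ z ≠ x ∧ z ≠ y)
    (c2 : (∃ e ∈ Q2.edges, e ∈ w.edges) ∨ ∃ z ∈ Q2.support, z ∈ w.support ∧ z ≠ x ∧ z ≠ y)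
    (c3 : (∃ e ∈ Q3.edges, e ∈ w.edges) ∨ ∃ z ∈ Q3.support, z ∈ w.support ∧ z ≠ x ∧ z ≠ y) :
    False := by
  have touch : ∀ Q : G.Walk x y,
      ((∃ e ∈ Q.edges, e ∈ w.edges) ∨ ∃ z ∈ Q.support, z ∈ w.support ∧ z ≠ x ∧ z ≠ y) →
      ∃ p, p ∈ emb.walkImage Q \ {emb.pos x, emb.pos y} ∧ p ∈ closure F := by
    rintro Q (⟨e, he, hew⟩ | ⟨z, hz, hzw, hzx, hzy⟩)
    · induction e with
      | _ p q =>
      obtain ⟨t, ht, htn⟩ := arc_pt emb (Q.adj_of_mem_edges he)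
      refine ⟨t, ⟨arc_mem_walk emb Q he ht, ?_⟩, hFw (arc_mem_walk emb w hew ht)⟩
      rintro (rfl | rfl) <;> exact htn ⟨_, rfl⟩
    · refine ⟨emb.pos z, ⟨(pos_mem_walk emb Q).2 hz, ?_⟩, hFw ((pos_mem_walk emb w).2 hzw)⟩
      rintro (h | h)
      · exact hzx (emb.pos_inj h)
      · exact hzy (emb.pos_inj h)
  have cap : ∀ Q Q' : G.Walk x y, Q.IsPath → Q'.IsPath →
      (∀ z, z ∈ Q.support → z ∈ Q'.support → z = x ∨ z = y) →
      (∃ z ∈ Q'.support, z ≠ x ∧ z ≠ y) →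
      emb.walkImage Q ∩ emb.walkImage Q' ⊆ {emb.pos x, emb.pos y} := by
    intro Q Q' hQ hQ' h ⟨t, ht, htx, hty⟩ z ⟨hz1, hz2⟩
    obtain ⟨v, hv1, hv2, rfl⟩ := walk_cap emb Q Q' (by
      intro e he he'
      have hxy' : s(x, y) ∈ Q'.edges := by
        induction e with
        | _ p q =>
        have hp := h p (Q.fst_mem_support_of_mem_edges he) (Q'.fst_mem_support_of_mem_edges he')
        have hq := h q (Q.snd_mem_support_of_mem_edges he) (Q'.snd_mem_support_of_mem_edges he')
        have hn := (Q.adj_of_mem_edges he).ne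
        rcases hp with rfl | rfl <;> rcases hq with rfl | rfl
        · exact absurd rfl hn
        · exact he'
        · rwa [Sym2.eq_swap]
        · exact absurd rfl hn
      rcases path_edge_ends Q' hQ' hxy' t ht with h | h
      · exact htx h
      · exact hty h) hz1 hz2
    rcases h v hv1 hv2 with rfl | rfl <;> simp
  obtain ⟨p1, m1, k1⟩ := touch _ c1
  obtain ⟨p2, m2, k2⟩ := touch _ c2
  obtain ⟨p3, m3, k3⟩ := touch _ c3
  exact theta_R (path_isArc emb Q1 h1 hxy) (path_isArc emb Q2 h2 hxy) (path_isArc emb Q3 h3 hxy)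
    (cap _ _ h1 h2 h12 i2) (cap _ _ h1 h3 h13 i3) (cap _ _ h2 h3 h23 i3) hF
    (hFi.mono_right (walkImage_image emb _)) (hFi.mono_right (walkImage_image emb _))
    (hFi.mono_right (walkImage_image emb _)) m1 m2 m3 k1 k2 k3
end
end Whit

namespace Whit
section
open SimpleGraph
variable {V : Type} {G : SimpleGraph V} (emb : PlanarEmbedding G)

lemma cycle_other {a : V} (w : G.Walk a a) (hw : w.IsCycle) : ∃ b ∈ w.support, a ≠ b := by
  cases w with
  | nil => exact absurd hw (by simp)
  | @cons _ v _ h P => exact ⟨v, by simp, h.ne⟩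

lemma backward {a : V} (w : G.Walk a a) (hw : w.IsCycle)
    (hind : ∀ u v : V, u ∈ w.support → v ∈ w.support → G.Adj u v → s(u, v) ∈ w.edges)
    (hconn : (G.induce {x : V | x ∉ w.support}).Connected) : emb.IsFacial w := by
  classical
  obtain ⟨⟨x0, hx0⟩⟩ := hconn.nonempty
  replace hx0 : x0 ∉ w.support := hx0
  obtain ⟨b, hb, hab⟩ := cycle_other w hw
  obtain ⟨P1, P2, hP1, hP2, hs, hc, he, hed⟩ := cycle_split w hw w.start_mem_support hb hab
  have hJ : emb.walkImage w = emb.walkImage P1 ∪ emb.walkImage P2 := by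
    ext z
    simp only [PlanarEmbedding.walkImage, Set.mem_union, Set.mem_image, Set.mem_ofPred_eq,
      Set.mem_iUnion, exists_prop, hs, he]
    grind
  have hcap : emb.walkImage P1 ∩ emb.walkImage P2 ⊆ {emb.pos a, emb.pos b} := by
    rintro z ⟨h1, h2⟩
    obtain ⟨x, hx1, hx2, rfl⟩ := walk_cap emb P1 P2 hed h1 h2
    rcases hc x hx1 hx2 with rfl | rfl <;> simp
  have hx0J : emb.pos x0 ∉ emb.walkImage w := fun h => hx0 ((pos_mem_walk emb w).1 h)
  obtain ⟨p, hp, hpK, hfr⟩ := jordan_R (path_isArc emb P1 hP1 hab) (path_isArc emb P2 hP2 hab) hcap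
    (x := emb.pos x0) (hJ ▸ hx0J)
  rw [← hJ] at hp hpK hfr
  set J := emb.walkImage w with hJd
  set K := connectedComponentIn Jᶜ (emb.pos x0) with hK
  have c1 : ∀ y, y ∉ w.support → emb.pos y ∈ K := by
    intro y hy
    by_cases hxy : x0 = y
    · rw [← hxy]; exact mem_connectedComponentIn hx0J
    obtain ⟨W, hW⟩ := reach_of_conn (S := {x | x ∈ w.support}) hconn (x := x0) (y := y) hx0 hy
    have ha := path_isArc emb W.bypass W.bypass_isPath hxy
    refine ha.preconn.subset_connectedComponentIn ha.left ?_ ha.right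
    intro z hz hzJ
    obtain ⟨x, hx1, hx2, -⟩ := walk_cap emb W.bypass w (by
      intro e h1 h2
      induction e with
      | _ p q =>
      exact hW p (W.support_bypass_subset_support (Walk.fst_mem_support_of_mem_edges _ h1))
        (Walk.fst_mem_support_of_mem_edges _ h2)) hz hzJ
    exact hW x (W.support_bypass_subset_support hx1) hx2
  have c2' : ∀ u v, G.Adj u v → s(u, v) ∉ w.edges → u ∉ w.support → emb.arc s(u, v) \ J ⊆ K := by
    rintro u v huv hne hu z ⟨hz, hzJ⟩
    have ha := arc_isArc emb huv
    by_cases hzv : z = emb.pos v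
    · subst hzv
      exact c1 v (fun h => hzJ ((pos_mem_walk emb w).2 h))
    have hK' : K = connectedComponentIn Jᶜ (emb.pos u) := connectedComponentIn_eq (c1 u hu)
    rw [hK']
    refine ha.half_preconn.subset_connectedComponentIn ⟨ha.left, ?_⟩ ?_ ⟨hz, hzv⟩
    · exact fun h => huv.ne (emb.pos_inj h)
    · rintro y ⟨hy1, hy2⟩ hyJ
      obtain ⟨x, hx1, hx2, rfl⟩ := walk_cap emb (.cons huv (.nil : G.Walk v v)) w
        (by simpa using hne) (arc_mem_walk emb _ (by simp) hy1) hyJ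
      simp at hx1
      rcases hx1 with rfl | rfl
      · exact hu hx2
      · exact hy2 rfl
  have c2 : ∀ u v, G.Adj u v → s(u, v) ∉ w.edges → emb.arc s(u, v) \ J ⊆ K := by
    intro u v huv hne
    by_cases hu : u ∈ w.support
    · have hv : v ∉ w.support := fun hv => hne (hind u v hu hv huv)
      rw [Sym2.eq_swap]
      rw [Sym2.eq_swap] at hne
      exact c2' v u huv.symm hne hv
    · exact c2' u v huv hne hu
  have c3 : emb.image \ J ⊆ K := by
    rintro z ⟨⟨x, rfl⟩ | hz, hzJ⟩
    · exact c1 x (fun h => hzJ ((pos_mem_walk emb w).2 h))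
    · simp only [Set.mem_iUnion] at hz
      obtain ⟨e, heG, hz⟩ := hz
      induction e with
      | _ u v =>
      exact c2 u v heG (fun h => hzJ (arc_mem_walk emb w h hz)) ⟨hz, hzJ⟩
  set D := connectedComponentIn Jᶜ p with hD
  have hDJ : D ⊆ Jᶜ := connectedComponentIn_subset _ _
  have hDK : ∀ z ∈ D, z ∉ K := by
    intro z hz hzK
    apply hpK
    rw [hK, connectedComponentIn_eq hzK, ← connectedComponentIn_eq hz]
    exact mem_connectedComponentIn hp
  have hDi : D ⊆ emb.imageᶜ := fun z hz hzi => hDK z hz (c3 ⟨hzi, hDJ hz⟩)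
  have hpD : p ∈ D := mem_connectedComponentIn hp
  refine ⟨p, hDi hpD, ?_⟩
  have : connectedComponentIn emb.imageᶜ p = D := by
    apply subset_antisymm
    · exact connectedComponentIn_mono p (Set.compl_subset_compl.2 (walkImage_image emb w))
    · exact isPreconnected_connectedComponentIn.subset_connectedComponentIn hpD hDi
  rw [this, hfr]
end
end Whit

namespace Whit
section
open SimpleGraph
variable {V : Type} {G : SimpleGraph V}

def ThetaFree {a : V} (w : G.Walk a a) : Prop :=
  ∀ (x y : V) (_ : x ≠ y) (Q1 Q2 Q3 : G.Walk x y), Q1.IsPath → Q2.IsPath → Q3.IsPath →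
    (∀ z, z ∈ Q1.support → z ∈ Q2.support → z = x ∨ z = y) →
    (∀ z, z ∈ Q1.support → z ∈ Q3.support → z = x ∨ z = y) →
    (∀ z, z ∈ Q2.support → z ∈ Q3.support → z = x ∨ z = y) →
    (∃ z ∈ Q2.support, z ≠ x ∧ z ≠ y) →
    (∃ z ∈ Q3.support, z ≠ x ∧ z ≠ y) →
    ((∃ e ∈ Q1.edges, e ∈ w.edges) ∨ ∃ z ∈ Q1.support, z ∈ w.support ∧ z ≠ x ∧ z ≠ y) →
    ((∃ e ∈ Q2.edges, e ∈ w.edges) ∨ ∃ z ∈ Q2.support, z ∈ w.support ∧ z ≠ x ∧ z ≠ y) →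
    ((∃ e ∈ Q3.edges, e ∈ w.edges) ∨ ∃ z ∈ Q3.support, z ∈ w.support ∧ z ≠ x ∧ z ≠ y) →
    False

lemma skew {a : V} {w : G.Walk a a} (TF : ThetaFree w)
    (h3 : ∀ S : Set V, S.ncard ≤ 2 → (G.induce Sᶜ).Connected)
    {s t : V} (P1 P2 P : G.Walk s t) (hP1 : P1.IsPath) (hP2 : P2.IsPath) (hP : P.IsPath)
    (hs : ∀ x, x ∈ w.support ↔ x ∈ P1.support ∨ x ∈ P2.support)
    (hc : ∀ x, x ∈ P1.support → x ∈ P2.support → x = s ∨ x = t)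
    (he : ∀ e, e ∈ P1.edges → e ∈ w.edges)
    (H : Set V) (HC : ∀ h ∈ H, h ∉ w.support)
    (Hcl : ∀ h ∈ H, ∀ x, G.Adj h x → x ∉ w.support → x ∈ H)
    (HO : ∀ h ∈ H, ∀ x, G.Adj h x → x ∈ P1.support → x = s ∨ x = t)
    (hPH : ∀ x ∈ P.support, x = s ∨ x = t ∨ x ∈ H)
    (hO : ∃ x ∈ P1.support, x ≠ s ∧ x ≠ t)
    (hT : (∃ x ∈ P2.support, x ≠ s ∧ x ≠ t) ∨ ∃ x, x ∈ H) : False := by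
  have hsw : s ∈ w.support := (hs s).2 (Or.inl P1.start_mem_support)
  have htw : t ∈ w.support := (hs t).2 (Or.inl P1.end_mem_support)
  let O : Set V := {x | x ∈ P1.support ∧ x ≠ s ∧ x ≠ t}
  let O' : Set V := {x | x ∈ P2.support ∧ x ≠ s ∧ x ≠ t}
  have hOd : ∀ x, x ∈ O ↔ x ∈ P1.support ∧ x ≠ s ∧ x ≠ t := fun x => Iff.rfl
  have hO'd : ∀ x, x ∈ O' ↔ x ∈ P2.support ∧ x ≠ s ∧ x ≠ t := fun x => Iff.rfl
  obtain ⟨o, ho⟩ : ∃ o, o ∈ O := hO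
  obtain ⟨τ, hτ⟩ : ∃ τ, τ ∈ O' ∪ H := by
    rcases hT with ⟨x, hx⟩ | ⟨x, hx⟩
    · exact ⟨x, Or.inl hx⟩
    · exact ⟨x, Or.inr hx⟩
  have hτn : τ ≠ s ∧ τ ≠ t := by
    rcases hτ with h | h
    · exact h.2
    · have := HC _ h
      constructor <;> rintro rfl <;> contradiction
  have hcard : ({s, t} : Set V).ncard ≤ 2 := (Set.ncard_insert_le _ _).trans (by simp)
  obtain ⟨W, hW⟩ := reach_of_conn (h3 _ hcard) (x := o) (y := τ)
    (by simp; exact ⟨ho.2.1, ho.2.2⟩) (by simpa using hτn)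
  obtain ⟨v, hv, R, hR, hRW, hRT⟩ := first_hit W (O' ∪ H) hτ
  obtain ⟨u, hu, Q, hQ, hQR, hQO⟩ := first_hit R.reverse O ho
  have q1 : ∀ x ∈ Q.support, x ≠ s ∧ x ≠ t := by
    intro x hx
    have := hW x (hRW x (by simpa using hQR x hx))
    simpa using this
  have q2 : ∀ x ∈ Q.support, x ∈ O' ∨ x ∈ H → x = v := fun x hx h =>
    hRT x (by simpa using hQR x hx) h
  clear_value O O'
  have huv : u ≠ v := by
    rintro rfl
    rcases hv with h | h
    · grind
    · have := HC _ h; grind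
  rcases hv with hv | hv
  · obtain ⟨A, B, hA, hB, k1, k2, k3⟩ := path_split P1 hP1 ((hOd u).1 hu).1
    obtain ⟨A2, B2, hA2, hB2, l1, l2, l3⟩ := path_split P2 hP2 ((hO'd v).1 hv).1
    have sA := A.start_mem_support
    have eA := A.end_mem_support
    have sB := B.start_mem_support
    have eB := B.end_mem_support
    have sA2 := A2.start_mem_support
    have eA2 := A2.end_mem_support
    have sB2 := B2.start_mem_support
    have eB2 := B2.end_mem_support
    have sP := P.start_mem_support
    have eP := P.end_mem_support
    have hu' := (hOd u).1 hu
    have hv' := (hO'd v).1 hv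
    have f1 : s ∉ B.support := fun h => hu'.2.1 (k2 s sA h).symm
    have f2 : t ∉ A.support := fun h => hu'.2.2 (k2 t h eB).symm
    have f3 : t ∉ A2.support := fun h => hv'.2.2 (l2 t h eB2).symm
    have f4 : ∀ x ∈ P.support, x ∈ w.support → x = s ∨ x = t := by grind
    have f5 : ∀ x ∈ Q.support, x ∈ w.support → x = u ∨ x = v := by
      intro x hx hxw
      have := q1 x hx; have := q2 x hx; have := hQO x hx
      grind
    have f6 : ∀ x ∈ A.support, x ∈ P1.support := fun x h => (k1 x).2 (Or.inl h)
    have f7 : ∀ x ∈ B.support, x ∈ P1.support := fun x h => (k1 x).2 (Or.inr h)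
    have f8 : ∀ x ∈ A2.support, x ∈ P2.support := fun x h => (l1 x).2 (Or.inl h)
    have f9 : u ∉ P2.support := by grind
    have f10 : v ∉ P1.support := by grind
    have f11 : ∀ x ∈ P1.support, x ∈ w.support := fun x h => (hs x).2 (Or.inl h)
    have f12 : ∀ x ∈ P2.support, x ∈ w.support := fun x h => (hs x).2 (Or.inr h)
    have f13 : ∀ x ∈ P.support, x ∈ Q.support → False := by
      intro x hx hxQ
      have := q1 x hxQ; have := q2 x hxQ
      have := hPH x hx
      grind
    obtain ⟨R2, hR2, m1, m2⟩ := path_join P B.reverse hP hB.reverse (by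
      intro x hx hx'
      simp only [Walk.support_reverse, List.mem_reverse] at hx'
      rcases f4 x hx (f11 x (f7 x hx')) with rfl | rfl
      · exact absurd hx' f1
      · rfl)
    obtain ⟨R3, hR3, n1, n2⟩ := path_join A2 Q hA2 hQ (by
      intro x hx hx'
      rcases f5 x hx' (f12 x (f8 x hx)) with rfl | rfl
      · exact absurd (f8 _ hx) f9
      · rfl)
    simp only [Walk.support_reverse, List.mem_reverse] at m1
    refine TF s u hu'.2.1.symm A R2 R3 hA hR2 hR3 ?_ ?_ ?_ ?_ ?_ ?_ ?_ ?_
    · intro z h1 h2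
      rcases (m1 z).1 h2 with h2 | h2
      · rcases f4 z h2 (f11 z (f6 z h1)) with rfl | rfl
        · exact Or.inl rfl
        · exact absurd h1 f2
      · exact Or.inr (k2 z h1 h2)
    · intro z h1 h2
      rcases (n1 z).1 h2 with h2 | h2
      · rcases hc z (f6 z h1) (f8 z h2) with rfl | rfl
        · exact Or.inl rfl
        · exact absurd h1 f2
      · rcases f5 z h2 (f11 z (f6 z h1)) with rfl | rfl
        · exact Or.inr rfl
        · exact absurd (f6 _ h1) f10
    · intro z h1 h2
      rcases (m1 z).1 h1 with h1 | h1 <;> rcases (n1 z).1 h2 with h2 | h2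
      · rcases f4 z h1 (f12 z (f8 z h2)) with rfl | rfl
        · exact Or.inl rfl
        · exact absurd h2 f3
      · exact (f13 z h1 h2).elim
      · rcases hc z (f7 z h1) (f8 z h2) with rfl | rfl
        · exact Or.inl rfl
        · exact absurd h2 f3
      · rcases f5 z h2 (f11 z (f7 z h1)) with rfl | rfl
        · exact Or.inr rfl
        · exact absurd (f7 _ h1) f10
    · exact ⟨t, (m1 t).2 (Or.inl eP), fun h => f2 (h ▸ sA), fun h => hu'.2.2 h.symm⟩
    · exact ⟨v, (n1 v).2 (Or.inl eA2), hv'.2.1, huv.symm⟩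
    · obtain ⟨e, hee⟩ := path_edge A hu'.2.1.symm
      exact Or.inl ⟨e, hee, he e ((k3 e).2 (Or.inl hee))⟩
    · exact Or.inr ⟨t, (m1 t).2 (Or.inl eP), htw, fun h => f2 (h ▸ sA), fun h => hu'.2.2 h.symm⟩
    · exact Or.inr ⟨v, (n1 v).2 (Or.inl eA2), f12 v hv'.1, hv'.2.1, huv.symm⟩
  · cases Q with
    | nil => exact huv rfl
    | @cons _ x _ h Q' =>
      have hx : x ∈ (Walk.cons h Q').support := by simp
      have hxn : x ≠ v := h.ne'
      have := q1 x hx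
      by_cases hxw : x ∈ w.support
      · rcases (hs x).1 hxw with hx1 | hx2
        · rcases HO v hv x h hx1 with h | h
          · exact this.1 h
          · exact this.2 h
        · exact hxn (q2 x hx (Or.inl ((hO'd x).2 ⟨hx2, this⟩)))
      · exact hxn (q2 x hx (Or.inr (Hcl v hv x h hxw)))

lemma no_chord {a : V} {w : G.Walk a a} (hw : w.IsCycle) (TF : ThetaFree w)
    (h3 : ∀ S : Set V, S.ncard ≤ 2 → (G.induce Sᶜ).Connected) (s t : V)
    (hs : s ∈ w.support) (ht : t ∈ w.support) (hst : G.Adj s t) : s(s, t) ∈ w.edges := by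
  by_contra hne
  obtain ⟨P1, P2, hP1, hP2, k1, k2, k3, k4⟩ := cycle_split w hw hs ht hst.ne
  refine skew TF h3 P1 P2 (.cons hst .nil) hP1 hP2 (by simp [hst.ne]) k1 k2
    (fun e h => (k3 e).2 (Or.inl h)) ∅ (by simp) (by simp) (by simp) (by simp)
    ((path_interior P1 hst.ne).resolve_left ?_) (Or.inl ((path_interior P2 hst.ne).resolve_left ?_))
  · exact fun h => hne ((k3 _).2 (Or.inl h))
  · exact fun h => hne ((k3 _).2 (Or.inr h))

lemma exit {H : Set V} {x y : V} (W : G.Walk x y) (hx : x ∈ H) (hy : y ∉ H) :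
    ∃ u ∈ H, ∃ v ∈ W.support, v ∉ H ∧ G.Adj u v := by
  induction W with
  | nil => exact absurd hx hy
  | @cons x v y h W ih =>
    by_cases hv : v ∈ H
    · obtain ⟨u, hu, v', hv', h1, h2⟩ := ih hv hy
      exact ⟨u, hu, v', by simp [hv'], h1, h2⟩
    · exact ⟨x, hx, v, by simp, hv, h⟩

lemma loop_supp {s t : V} (P : G.Walk s t) (hP : P.IsPath) (h : s = t) : ∀ x ∈ P.support, x = t := by
  subst h
  have := Walk.isPath_iff_nil.1 hP
  intro x hx
  rw [this.eq_nil] at hx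
  simpa using hx

lemma path_via (H : Set V) {s t h h' : V} (hsh : G.Adj s h) (hth : G.Adj h' t) (hhH : h ∈ H)
    (hhH' : h' ∈ H) (W : G.Walk h h') (hW : ∀ z ∈ W.support, z ∈ H) :
    ∃ Z : G.Walk s t, Z.IsPath ∧ ∀ x ∈ Z.support, x = s ∨ x = t ∨ x ∈ H := by
  classical
  refine ⟨(Walk.cons hsh (W.append (.cons hth .nil))).bypass, Walk.bypass_isPath _, ?_⟩
  intro x hx
  replace hx := Walk.support_bypass_subset_support _ hx
  simp only [Walk.support_cons, List.mem_cons, Walk.mem_support_append_iff, Walk.support_nil,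
    List.not_mem_nil, or_false] at hx
  rcases hx with h | h | h | h
  · exact Or.inl h
  · exact Or.inr (Or.inr (hW x h))
  · subst h; exact Or.inr (Or.inr hhH')
  · exact Or.inr (Or.inl h)

lemma full {a : V} {w : G.Walk a a} (hw : w.IsCycle) (TF : ThetaFree w)
    (h3 : ∀ S : Set V, S.ncard ≤ 2 → (G.induce Sᶜ).Connected)
    (H : Set V) (h0 : V) (hh0 : h0 ∈ H) (HC : ∀ h ∈ H, h ∉ w.support)
    (Hcl : ∀ h ∈ H, ∀ x, G.Adj h x → x ∉ w.support → x ∈ H)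
    (Hco : ∀ x ∈ H, ∀ y ∈ H, ∃ W : G.Walk x y, ∀ z ∈ W.support, z ∈ H)
    (p : V) (hp : p ∈ w.support) : ∃ h ∈ H, G.Adj p h := by
  classical
  by_contra hcon
  let N : Set V := {c | c ∈ w.support ∧ ∃ h ∈ H, G.Adj c h}
  have hNd : ∀ c, c ∈ N ↔ c ∈ w.support ∧ ∃ h ∈ H, G.Adj c h := fun c => Iff.rfl
  have hpN : p ∉ N := fun h => hcon h.2
  have hpH : p ∉ H := fun h => HC p h hp
  have get : ∀ S : Set V, S.ncard ≤ 2 → S ⊆ N → ∃ n ∈ N, n ∉ S := by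
    intro S hS hSN
    obtain ⟨W, hW⟩ := reach_of_conn (h3 S hS) (x := h0) (y := p)
      (fun h => HC _ hh0 (hSN h).1) (fun h => hpN (hSN h))
    obtain ⟨u, hu, v, hv, hvH, huv⟩ := exit W hh0 hpH
    have hvw : v ∈ w.support := by
      by_contra h
      exact hvH (Hcl u hu v huv h)
    exact ⟨v, ⟨hvw, u, hu, huv.symm⟩, hW v hv⟩
  clear_value N
  obtain ⟨n, hn, -⟩ := get ∅ (by simp) (by simp)
  obtain ⟨m, hm, hmn⟩ := get {n} (by simp) (by simpa using hn)
  replace hmn : m ≠ n := by simpa using hmn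
  have hpn : p ≠ n := by rintro rfl; exact hpN hn
  obtain ⟨P1, P2, hP1, hP2, k1, k2, k3, k4⟩ := cycle_split w hw hp ((hNd n).1 hn).1 hpn
  obtain ⟨s, hs, A1, B1, hA1, hB1, a1, a2, a3, a4⟩ := path_first P1 hP1 N hn
  obtain ⟨t, ht, A2, B2, hA2, hB2, b1, b2, b3, b4⟩ := path_first P2 hP2 N hn
  have sA1 := A1.start_mem_support
  have eA1 := A1.end_mem_support
  have sB1 := B1.start_mem_support
  have eB1 := B1.end_mem_support
  have sA2 := A2.start_mem_support
  have eA2 := A2.end_mem_support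
  have sB2 := B2.start_mem_support
  have eB2 := B2.end_mem_support
  have hps : p ≠ s := by rintro rfl; exact hpN hs
  have hpt : p ≠ t := by rintro rfl; exact hpN ht
  have i1 : ∀ x ∈ A1.support, x ∈ P1.support := fun x h => (a1 x).2 (Or.inl h)
  have i2 : ∀ x ∈ B1.support, x ∈ P1.support := fun x h => (a1 x).2 (Or.inr h)
  have i3 : ∀ x ∈ A2.support, x ∈ P2.support := fun x h => (b1 x).2 (Or.inl h)
  have i4 : ∀ x ∈ B2.support, x ∈ P2.support := fun x h => (b1 x).2 (Or.inr h)
  have j1 : n ∈ A1.support → n = s := fun h => a4 n h hn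
  have j2 : n ∈ A2.support → n = t := fun h => b4 n h hn
  have j3 : p ∉ B1.support := fun h => hps (a2 p sA1 h)
  have j4 : p ∉ B2.support := fun h => hpt (b2 p sA2 h)
  have hst : s ≠ t := by
    intro hst
    have hsn : s = n := by
      rcases k2 s (i1 s eA1) (hst ▸ i3 t eA2) with h | h
      · exact absurd h.symm hps
      · exact h
    have htn : t = n := hst ▸ hsn
    rcases (k1 m).1 ((hNd m).1 hm).1 with h | h
    · rcases (a1 m).1 h with h | h
      · exact hmn ((a4 m h hm).trans hsn)
      · exact hmn (loop_supp B1 hB1 hsn m h)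
    · rcases (b1 m).1 h with h | h
      · exact hmn ((b4 m h hm).trans htn)
      · exact hmn (loop_supp B2 hB2 htn m h)
  obtain ⟨R1, hR1, r1, r2⟩ := path_join A1.reverse A2 hA1.reverse hA2 (by
    intro x h1 h2
    simp only [Walk.support_reverse, List.mem_reverse] at h1
    rcases k2 x (i1 x h1) (i3 x h2) with rfl | rfl
    · rfl
    · exact absurd ((j1 h1).symm.trans (j2 h2)) hst)
  obtain ⟨R2, hR2, s1, s2⟩ := path_join B1 B2.reverse hB1 hB2.reverse (by
    intro x h1 h2
    simp only [Walk.support_reverse, List.mem_reverse] at h2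
    rcases k2 x (i2 x h1) (i4 x h2) with rfl | rfl
    · exact absurd h1 j3
    · rfl)
  simp only [Walk.support_reverse, List.mem_reverse, Walk.edges_reverse] at r1 r2 s1 s2
  obtain ⟨hsw, h, hhH, hsh⟩ := (hNd s).1 hs
  obtain ⟨htw, h', hhH', hth⟩ := (hNd t).1 ht
  obtain ⟨W, hW⟩ := Hco h hhH h' hhH'
  obtain ⟨Z, hZp, hZ⟩ := path_via H hsh hth.symm hhH hhH' W hW
  refine skew TF h3 R1 R2 Z hR1 hR2 hZp ?_ ?_ ?_ H HC Hcl ?_ hZ ?_ (Or.inr ⟨h0, hh0⟩)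
  · intro x; rw [k1, a1, b1, r1, s1]; exact or_or_or_comm
  · intro x h1 h2
    rcases (r1 x).1 h1 with h1 | h1 <;> rcases (s1 x).1 h2 with h2 | h2
    · exact Or.inl (a2 x h1 h2)
    · rcases k2 x (i1 x h1) (i4 x h2) with rfl | rfl
      · exact absurd h2 j4
      · exact Or.inl (j1 h1)
    · rcases k2 x (i2 x h2) (i3 x h1) with rfl | rfl
      · exact absurd h2 j3
      · exact Or.inr (j2 h1)
    · exact Or.inr (b2 x h1 h2)
  · intro e h
    rw [k3, a3, b3]
    exact ((r2 e).1 h).imp Or.inl Or.inl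
  · intro y hy x hyx hx
    have hxw : x ∈ w.support := by
      rw [k1]
      rcases (r1 x).1 hx with h | h
      · exact Or.inl (i1 x h)
      · exact Or.inr (i3 x h)
    have hxN : x ∈ N := (hNd x).2 ⟨hxw, y, hy, hyx.symm⟩
    rcases (r1 x).1 hx with h | h
    · exact Or.inl (a4 x h hxN)
    · exact Or.inr (b4 x h hxN)
  · exact ⟨p, (r1 p).2 (Or.inl sA1), hps, hpt⟩

lemma tripod (H : Set V) (Hco : ∀ x ∈ H, ∀ y ∈ H, ∃ W : G.Walk x y, ∀ z ∈ W.support, z ∈ H)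
    {a1 a2 a3 : V} (h12 : a1 ≠ a2) (h13 : a1 ≠ a3) (h23 : a2 ≠ a3) (n1 : a1 ∉ H) (n2 : a2 ∉ H)
    (n3 : a3 ∉ H) (e1 : ∃ h ∈ H, G.Adj a1 h) (e2 : ∃ h ∈ H, G.Adj a2 h)
    (e3 : ∃ h ∈ H, G.Adj a3 h) :
    ∃ c ∈ H, ∃ (T1 : G.Walk c a1) (T2 : G.Walk c a2) (T3 : G.Walk c a3),
      T1.IsPath ∧ T2.IsPath ∧ T3.IsPath ∧
      (∀ x ∈ T1.support, x = a1 ∨ x ∈ H) ∧ (∀ x ∈ T2.support, x = a2 ∨ x ∈ H) ∧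
      (∀ x ∈ T3.support, x = a3 ∨ x ∈ H) ∧
      (∀ x ∈ T1.support, x ∈ T2.support → x = c) ∧
      (∀ x ∈ T1.support, x ∈ T3.support → x = c) ∧
      (∀ x ∈ T2.support, x ∈ T3.support → x = c) := by
  classical
  obtain ⟨h1, m1, k1⟩ := e1
  obtain ⟨h2, m2, k2⟩ := e2
  obtain ⟨h3, m3, k3⟩ := e3
  obtain ⟨W, hW⟩ := Hco h1 m1 h2 m2
  obtain ⟨W', hW'⟩ := Hco h3 m3 h2 m2
  obtain ⟨P, hP, hPs⟩ : ∃ P : G.Walk a1 h2, P.IsPath ∧ ∀ x ∈ P.support, x = a1 ∨ x ∈ H := by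
    refine ⟨(Walk.cons k1 W).bypass, Walk.bypass_isPath _, fun x hx => ?_⟩
    have := Walk.support_bypass_subset_support _ hx
    simp only [Walk.support_cons, List.mem_cons] at this
    exact this.imp id (hW x)
  obtain ⟨c, hc, R, hR, hRs, hRP⟩ := first_hit (Walk.cons k3 W') {x | x ∈ P.support}
    P.end_mem_support
  replace hRs : ∀ x ∈ R.support, x = a3 ∨ x ∈ H := by
    intro x hx
    have := hRs x hx
    simp only [Walk.support_cons, List.mem_cons] at this
    exact this.imp id (hW' x)
  replace hRP : ∀ z ∈ R.support, z ∈ P.support → z = c := hRP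
  have hcH : c ∈ H := by
    rcases hRs c R.end_mem_support with h | h
    · rcases hPs c hc with h' | h'
      · exact absurd (h'.symm.trans h) h13
      · exact h'
    · exact h
  obtain ⟨A, B, hA, hB, s1, s2, -⟩ := path_split P hP hc
  have hBs : ∀ x ∈ B.support, x ∈ H := by
    intro x hx
    rcases hPs x ((s1 x).2 (Or.inr hx)) with rfl | h
    · have := s2 _ A.start_mem_support hx
      rw [this]; exact hcH
    · exact h
  obtain ⟨T2, hT2, t1, -⟩ := path_join B (.cons k2.symm .nil) hB (by simp [k2.ne']) (by
    intro x hx hx'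
    simp at hx'
    rcases hx' with rfl | rfl
    · rfl
    · exact absurd (hBs _ hx) n2)
  simp only [Walk.support_cons, Walk.support_nil, List.mem_cons, List.not_mem_nil, or_false] at t1
  have t1' : ∀ x ∈ T2.support, x ∈ B.support ∨ x = a2 := by
    intro x hx
    rcases (t1 x).1 hx with h | rfl | h
    · exact Or.inl h
    · exact Or.inl B.end_mem_support
    · exact Or.inr h
  have pA : ∀ x ∈ A.support, x ∈ P.support := fun x h => (s1 x).2 (Or.inl h)
  have pB : ∀ x ∈ B.support, x ∈ P.support := fun x h => (s1 x).2 (Or.inr h)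
  refine ⟨c, hcH, A.reverse, T2, R.reverse, hA.reverse, hT2, hR.reverse, ?_, ?_, ?_, ?_, ?_, ?_⟩ <;>
    try simp only [Walk.support_reverse, List.mem_reverse]
  · exact fun x hx => hPs x (pA x hx)
  · exact fun x hx => (t1' x hx).symm.imp id (hBs x)
  · exact hRs
  · intro x hx hx'
    rcases t1' x hx' with h | rfl
    · exact s2 x hx h
    · rcases hPs _ (pA _ hx) with h | h
      · exact absurd h.symm h12
      · exact absurd h n2
  · exact fun x hx hx' => hRP x hx' (pA x hx)
  · intro x hx hx'
    rcases t1' x hx with h | rfl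
    · exact hRP x hx' (pB x h)
    · rcases hRs _ hx' with h | h
      · exact absurd h h23
      · exact absurd h n2

lemma two_comp {a : V} {w : G.Walk a a} (hw : w.IsCycle) (TF : ThetaFree w)
    (H H' : Set V) (hd : ∀ x ∈ H, x ∉ H')
    (HC : ∀ h ∈ H, h ∉ w.support) (HC' : ∀ h ∈ H', h ∉ w.support)
    (Hco : ∀ x ∈ H, ∀ y ∈ H, ∃ W : G.Walk x y, ∀ z ∈ W.support, z ∈ H)
    (Hco' : ∀ x ∈ H', ∀ y ∈ H', ∃ W : G.Walk x y, ∀ z ∈ W.support, z ∈ H')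
    (f : ∀ p ∈ w.support, ∃ h ∈ H, G.Adj p h) (f' : ∀ p ∈ w.support, ∃ h ∈ H', G.Adj p h) :
    False := by
  obtain ⟨a2, m2, h12⟩ := cycle_other w hw
  obtain ⟨a3, m3, h31, h32⟩ : ∃ a3 ∈ w.support, a3 ≠ a ∧ a3 ≠ a2 := by
    obtain ⟨P1, P2, hP1, hP2, k1, k2, k3, k4⟩ := cycle_split w hw w.start_mem_support m2 h12
    rcases path_interior P1 h12 with h | ⟨x, hx, h⟩
    · rcases path_interior P2 h12 with h' | ⟨x, hx, h'⟩
      · exact absurd h' (k4 _ h)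
      · exact ⟨x, (k1 x).2 (Or.inr hx), h'⟩
    · exact ⟨x, (k1 x).2 (Or.inl hx), h⟩
  have m1 := w.start_mem_support
  have nH : ∀ p ∈ w.support, p ∉ H := fun p hp h => HC p h hp
  have nH' : ∀ p ∈ w.support, p ∉ H' := fun p hp h => HC' p h hp
  obtain ⟨c, hc, T1, T2, T3, t1, t2, t3, s1, s2, s3, i12, i13, i23⟩ := tripod H Hco h12 h31.symm
    h32.symm (nH _ m1) (nH _ m2) (nH _ m3) (f _ m1) (f _ m2) (f _ m3)
  obtain ⟨c', hc', T1', T2', T3', t1', t2', t3', s1', s2', s3', i12', i13', i23'⟩ :=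
    tripod H' Hco' h12 h31.symm h32.symm (nH' _ m1) (nH' _ m2) (nH' _ m3) (f' _ m1) (f' _ m2)
    (f' _ m3)
  have join : ∀ (b : V) (_ : b ∈ w.support) (T : G.Walk c b) (T' : G.Walk c' b), T.IsPath →
      T'.IsPath → (∀ x ∈ T.support, x = b ∨ x ∈ H) → (∀ x ∈ T'.support, x = b ∨ x ∈ H') →
      ∃ R : G.Walk c c', R.IsPath ∧ (∀ x, x ∈ R.support ↔ x ∈ T.support ∨ x ∈ T'.support) ∧
        ∃ z ∈ R.support, z ∈ w.support ∧ z ≠ c ∧ z ≠ c' := by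
    intro b hb T T' hT hT' k k'
    obtain ⟨R, hR, r1, -⟩ := path_join T T'.reverse hT hT'.reverse (by
      intro x hx hx'
      simp only [Walk.support_reverse, List.mem_reverse] at hx'
      rcases k x hx with h | h
      · exact h
      rcases k' x hx' with h' | h'
      · exact h'
      exact absurd h' (hd x h))
    simp only [Walk.support_reverse, List.mem_reverse] at r1
    refine ⟨R, hR, r1, b, (r1 b).2 (Or.inl T.end_mem_support), hb, ?_, ?_⟩
    · rintro rfl; exact nH _ hb hc
    · rintro rfl; exact nH' _ hb hc'
  have cap : ∀ (b d : V) (_ : b ∈ w.support) (_ : d ∈ w.support) (_ : b ≠ d)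
      (T : G.Walk c b) (T' : G.Walk c' b) (U : G.Walk c d) (U' : G.Walk c' d)
      (R S : G.Walk c c'),
      (∀ x ∈ T.support, x = b ∨ x ∈ H) → (∀ x ∈ T'.support, x = b ∨ x ∈ H') →
      (∀ x ∈ U.support, x = d ∨ x ∈ H) → (∀ x ∈ U'.support, x = d ∨ x ∈ H') →
      (∀ x, x ∈ R.support ↔ x ∈ T.support ∨ x ∈ T'.support) →
      (∀ x, x ∈ S.support ↔ x ∈ U.support ∨ x ∈ U'.support) →
      (∀ x ∈ T.support, x ∈ U.support → x = c) →
      (∀ x ∈ T'.support, x ∈ U'.support → x = c') →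
      ∀ z, z ∈ R.support → z ∈ S.support → z = c ∨ z = c' := by
    intro b d hb hd' hbd T T' U U' R S k1 k2 k3 k4 r s i i' z hR hS
    rcases (r z).1 hR with h | h <;> rcases (s z).1 hS with h' | h'
    · exact Or.inl (i z h h')
    · exfalso
      rcases k1 z h with rfl | h1 <;> rcases k4 z h' with rfl | h2
      · exact hbd rfl
      · exact nH' _ hb h2
      · exact nH _ hd' h1
      · exact hd _ h1 h2
    · exfalso
      rcases k2 z h with rfl | h1 <;> rcases k3 z h' with rfl | h2
      · exact hbd rfl
      · exact nH _ hb h2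
      · exact nH' _ hd' h1
      · exact hd _ h2 h1
    · exact Or.inr (i' z h h')
  obtain ⟨R1, p1, r1, z1⟩ := join a m1 T1 T1' t1 t1' s1 s1'
  obtain ⟨R2, p2, r2, z2⟩ := join a2 m2 T2 T2' t2 t2' s2 s2'
  obtain ⟨R3, p3, r3, z3⟩ := join a3 m3 T3 T3' t3 t3' s3 s3'
  have hcc : c ≠ c' := by rintro rfl; exact hd _ hc hc'
  exact TF c c' hcc R1 R2 R3 p1 p2 p3
    (cap a a2 m1 m2 h12 T1 T1' T2 T2' R1 R2 s1 s1' s2 s2' r1 r2 i12 i12')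
    (cap a a3 m1 m3 h31.symm T1 T1' T3 T3' R1 R3 s1 s1' s3 s3' r1 r3 i13 i13')
    (cap a2 a3 m2 m3 h32.symm T2 T2' T3 T3' R2 R3 s2 s2' s3 s3' r2 r3 i23 i23')
    (by obtain ⟨z, h, -, h'⟩ := z2; exact ⟨z, h, h'⟩)
    (by obtain ⟨z, h, -, h'⟩ := z3; exact ⟨z, h, h'⟩) (Or.inr z1) (Or.inr z2) (Or.inr z3)

def comp (w : List V) (G : SimpleGraph V) (x : V) : Set V :=
  {z | ∃ W : G.Walk x z, ∀ v ∈ W.support, v ∉ w}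

lemma comp_off {w : List V} {x : V} : ∀ h ∈ comp w G x, h ∉ w := by
  rintro h ⟨W, hW⟩
  exact hW _ W.end_mem_support

lemma comp_self {w : List V} {x : V} (hx : x ∉ w) : x ∈ comp w G x := ⟨.nil, by simpa using hx⟩

lemma comp_cl {w : List V} {x : V} : ∀ h ∈ comp w G x, ∀ y, G.Adj h y → y ∉ w → y ∈ comp w G x := by
  rintro h ⟨W, hW⟩ y hy hyw
  refine ⟨W.append (.cons hy .nil), ?_⟩
  intro v hv
  simp only [Walk.support_cons, List.mem_cons, Walk.mem_support_append_iff, Walk.support_nil,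
    List.not_mem_nil, or_false] at hv
  rcases hv with h | rfl | rfl
  · exact hW _ h
  · exact hW _ W.end_mem_support
  · exact hyw

lemma comp_co {w : List V} {x : V} : ∀ y ∈ comp w G x, ∀ z ∈ comp w G x,
    ∃ W : G.Walk y z, ∀ v ∈ W.support, v ∈ comp w G x := by
  classical
  rintro y ⟨W, hW⟩ z ⟨W', hW'⟩
  refine ⟨W.reverse.append W', ?_⟩
  intro v hv
  simp only [Walk.mem_support_append_iff, Walk.support_reverse, List.mem_reverse] at hv
  rcases hv with h | h
  · exact ⟨W.takeUntil v h, fun u hu => hW u (W.support_takeUntil_subset_support h hu)⟩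
  · exact ⟨W'.takeUntil v h, fun u hu => hW' u (W'.support_takeUntil_subset_support h hu)⟩

lemma forward [Fintype V] (hcard : 3 < Fintype.card V)
    (h3 : ∀ S : Set V, S.ncard ≤ 2 → (G.induce Sᶜ).Connected) {a : V} {w : G.Walk a a}
    (hw : w.IsCycle) (TF : ThetaFree w) :
    ((∀ u v : V, u ∈ w.support → v ∈ w.support → G.Adj u v → s(u, v) ∈ w.edges) ∧
        (G.induce {x : V | x ∉ w.support}).Connected) := by
  classical
  have hch := fun s t hs ht hst => no_chord hw TF h3 s t hs ht hst
  refine ⟨hch, ?_⟩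
  rw [connected_iff]
  constructor
  · rintro ⟨x, hx⟩ ⟨y, hy⟩
    have hx' : x ∉ w.support := hx
    have hy' : y ∉ w.support := hy
    by_contra hnr
    refine two_comp hw TF (comp w.support G x) (comp w.support G y) ?_ comp_off comp_off comp_co
      comp_co (fun p hp => full hw TF h3 _ x (comp_self hx') comp_off comp_cl comp_co p hp)
      (fun p hp => full hw TF h3 _ y (comp_self hy') comp_off comp_cl comp_co p hp)
    rintro z ⟨W, hW⟩ ⟨W', hW'⟩
    apply hnr
    have hZ : ∀ v ∈ (W.append W'.reverse).support, v ∈ {x : V | x ∉ w.support} := by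
      intro v hv
      simp only [Walk.mem_support_append_iff, Walk.support_reverse, List.mem_reverse] at hv
      rcases hv with h | h
      · exact hW v h
      · exact hW' v h
    exact ⟨(W.append W'.reverse).induce _ hZ⟩
  · by_contra hne
    have hall : ∀ x, x ∈ w.support := by
      intro x
      by_contra hx
      exact hne ⟨⟨x, hx⟩⟩
    obtain ⟨b, hb, hab⟩ := cycle_other w hw
    obtain ⟨P1, P2, hP1, hP2, k1, k2, k3, k4⟩ := cycle_split w hw w.start_mem_support hb hab
    obtain ⟨x1, hx1⟩ := path_head P1 hP1
    obtain ⟨x2, hx2⟩ := path_head P2 hP2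
    have hcS : (({x1, x2} : Set V) \ {a}).ncard ≤ 2 :=
      (Set.ncard_le_ncard Set.diff_subset (Set.toFinite _)).trans
        ((Set.ncard_insert_le _ _).trans (by simp))
    obtain ⟨z, hz⟩ : ∃ z, z ∉ ({a, x1, x2} : Finset V) := by
      by_contra hcon
      push Not at hcon
      have : Finset.univ ⊆ ({a, x1, x2} : Finset V) := fun z _ => hcon z
      have := Finset.card_le_card this
      have h' := Finset.card_le_three (a := a) (b := x1) (c := x2)
      rw [Finset.card_univ] at this
      omega
    simp only [Finset.mem_insert, Finset.mem_singleton, not_or] at hz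
    obtain ⟨W, hW⟩ := reach_of_conn (h3 _ hcS) (x := a) (y := z) (by simp) (by simp [hz])
    obtain ⟨u, hu, v, hv, hva, huv⟩ := exit W (H := {a}) rfl (by simpa using hz.1)
    replace hu : u = a := hu
    subst hu
    have := hch u v (hall _) (hall _) huv
    refine hW v hv ⟨?_, hva⟩
    rcases (k3 _).1 this with h | h
    · exact Or.inl (hx1 v h)
    · exact Or.inr (hx2 v h)

lemma thetaFree_of_facial (emb : PlanarEmbedding G) {a : V} {w : G.Walk a a} (h : emb.IsFacial w) :
    ThetaFree w := by
  obtain ⟨z, hz, hJ⟩ := h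
  intro x y hxy Q1 Q2 Q3 h1 h2 h3 h12 h13 h23 i2 i3 c1 c2 c3
  exact theta_G emb w hxy Q1 Q2 Q3 h1 h2 h3 h12 h13 h23 i2 i3 (connectedComponentIn emb.imageᶜ z)
    isPreconnected_connectedComponentIn
    (Set.disjoint_left.2 fun p hp => connectedComponentIn_subset _ _ hp)
    (hJ ▸ frontier_subset_closure) c1 c2 c3
end
end Whit

/-- **Whitney's theorem.** In a 3-connected planar graph, a cycle `C` is a
facial cycle of every planar embedding if and only if `C` is an induced
subgraph and `G - V(C)` is connected. -/
theorem whitney_facial_cycles {V : Type} [Fintype V] (G : SimpleGraph V)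
    (h3 : IsKConnected 3 G) (hp : G.Planar) (a : V) (w : G.Walk a a)
    (hw : w.IsCycle) :
    (∀ emb : PlanarEmbedding G, emb.IsFacial w) ↔
      ((∀ u v : V, u ∈ w.support → v ∈ w.support → G.Adj u v → s(u, v) ∈ w.edges) ∧
        (G.induce {x : V | x ∉ w.support}).Connected) := by
  constructor
  · intro h
    exact Whit.forward h3.1 h3.2 hw (Whit.thetaFree_of_facial hp.some (h hp.some))
  · rintro ⟨h1, h2⟩ emb
    exact Whit.backward emb w hw h1 h2
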